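/- arXiv:nlin/0612025 — 9 statements merged into one kernel-verified Lean document; each statement's English description precedes it below -/
import Mathlib

section
/- With the canonical bracket {F,G}_0 := Σ_i(∂F/∂μ_i ∂G/∂λ_i − ∂F/∂λ_i ∂G/∂μ_i) on smooth functions on U, for all real x ≠ y one has the Sklyanin-bracket relation {B(x), A(y)}_0 = (η/(x−y))·(B(x)A(y) − B(y)A(x)), where both sides are smooth functions on U. -/
noncomputable section

/-- The open set `U ⊂ ℝ^{2n}` of points `(λ, μ)` with the `λ_i` pairwise distinct. -/
def U (n : ℕ) : Set ((Fin n → ℝ) × (Fin n → ℝ)) := {z | Function.Injective z.1}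

/-- `A(x) := α ∏_{i=1}^n (x − λ_i)`. -/
def Afun (n : ℕ) (α : ℝ) (x : ℝ) (z : (Fin n → ℝ) × (Fin n → ℝ)) : ℝ :=
  α * ∏ i, (x - z.1 i)

/-- `A'(λ_i)`, the derivative of the polynomial `A` at `λ_i`. -/
def Ader (n : ℕ) (α : ℝ) (z : (Fin n → ℝ) × (Fin n → ℝ)) (i : Fin n) : ℝ :=
  deriv (fun x => Afun n α x z) (z.1 i)

/-- The polynomial `A(x)/(x − λ_i) = α ∏_{j ≠ i} (x − λ_j)`. -/
def lagr (n : ℕ) (α : ℝ) (z : (Fin n → ℝ) × (Fin n → ℝ)) (i : Fin n) (x : ℝ) : ℝ :=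
  α * ∏ j ∈ Finset.univ.erase i, (x - z.1 j)

/-- `B(x) := A(x)(β/α + Σ_i e^{ημ_i}/((x−λ_i)A'(λ_i)))`, written with the polynomial
`A(x)/(x−λ_i)`, so `B` is a polynomial in `x`. -/
def Bfun (n : ℕ) (α β η : ℝ) (x : ℝ) (z : (Fin n → ℝ) × (Fin n → ℝ)) : ℝ :=
  (β / α) * Afun n α x z + ∑ i, Real.exp (η * z.2 i) * lagr n α z i x / Ader n α z i

/-- `C(x) := A(x)(γ/α − Σ_i d(λ_i)e^{−ημ_i}/((x−λ_i)A'(λ_i)))`, written with the polynomial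
`A(x)/(x−λ_i)`, so `C` is a polynomial in `x`. -/
def Cfun (n : ℕ) (α γ η : ℝ) (d : Polynomial ℝ) (x : ℝ)
    (z : (Fin n → ℝ) × (Fin n → ℝ)) : ℝ :=
  (γ / α) * Afun n α x z
    - ∑ i, d.eval (z.1 i) * Real.exp (-(η * z.2 i)) * lagr n α z i x / Ader n α z i

/-- Partial derivative of `F` with respect to `λ_i`. -/
def pdLam {n : ℕ} (F : (Fin n → ℝ) × (Fin n → ℝ) → ℝ) (i : Fin n)
    (z : (Fin n → ℝ) × (Fin n → ℝ)) : ℝ :=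
  fderiv ℝ F z (Pi.single i 1, 0)

/-- Partial derivative of `F` with respect to `μ_i`. -/
def pdMu {n : ℕ} (F : (Fin n → ℝ) × (Fin n → ℝ) → ℝ) (i : Fin n)
    (z : (Fin n → ℝ) × (Fin n → ℝ)) : ℝ :=
  fderiv ℝ F z (0, Pi.single i 1)

/-- The canonical bracket `{F,G}_0 := Σ_i (∂F/∂μ_i ∂G/∂λ_i − ∂F/∂λ_i ∂G/∂μ_i)`. -/
def bracket0 {n : ℕ} (F G : (Fin n → ℝ) × (Fin n → ℝ) → ℝ)
    (z : (Fin n → ℝ) × (Fin n → ℝ)) : ℝ :=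
  ∑ i, (pdMu F i z * pdLam G i z - pdLam F i z * pdMu G i z)

theorem Afun_eq_sub_mul_lagr {n : ℕ} (α x : ℝ) (w : (Fin n → ℝ) × (Fin n → ℝ)) (i : Fin n) :
    Afun n α x w = (x - w.1 i) * lagr n α w i x := by
  rw [Afun, lagr, ← Finset.mul_prod_erase Finset.univ _ (Finset.mem_univ i)]
  ring

theorem Ader_eq_lagr {n : ℕ} (α : ℝ) (w : (Fin n → ℝ) × (Fin n → ℝ)) (i : Fin n) :
    Ader n α w i = lagr n α w i (w.1 i) := by
  have hd : DifferentiableAt ℝ (fun x => lagr n α w i x) (w.1 i) := by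
    unfold lagr
    fun_prop
  have h := ((hasDerivAt_id (w.1 i)).sub_const (w.1 i)).mul hd.hasDerivAt
  rw [Ader, funext fun x => Afun_eq_sub_mul_lagr α x w i]
  refine h.deriv.trans ?_
  simp

theorem Ader_ne_zero {n : ℕ} {α : ℝ} (hα : α ≠ 0) {w : (Fin n → ℝ) × (Fin n → ℝ)}
    (hw : w ∈ U n) (i : Fin n) : Ader n α w i ≠ 0 := by
  rw [Ader_eq_lagr, lagr]
  refine mul_ne_zero hα (Finset.prod_ne_zero_iff.mpr fun j hj => sub_ne_zero.mpr fun h => ?_)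
  exact Finset.ne_of_mem_erase hj (hw h).symm

theorem differentiable_Afun (n : ℕ) (α x : ℝ) : Differentiable ℝ (Afun n α x) := by
  unfold Afun
  fun_prop

theorem differentiableAt_Bfun {n : ℕ} {α : ℝ} (β η x : ℝ) (hα : α ≠ 0)
    {w : (Fin n → ℝ) × (Fin n → ℝ)} (hw : w ∈ U n) :
    DifferentiableAt ℝ (Bfun n α β η x) w := by
  have hA := differentiable_Afun n α x w
  have hl (i : Fin n) : DifferentiableAt ℝ (fun v => lagr n α v i x) w := by
    unfold lagr
    fun_prop
  have hD (i : Fin n) : DifferentiableAt ℝ (fun v => Ader n α v i) w := by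
    simp only [Ader_eq_lagr, lagr]
    fun_prop
  have hne (i : Fin n) := Ader_ne_zero hα hw i
  unfold Bfun
  refine (hA.const_mul _).add (DifferentiableAt.fun_sum fun i _ => ?_)
  have he : DifferentiableAt ℝ (fun v : (Fin n → ℝ) × (Fin n → ℝ) => Real.exp (η * v.2 i)) w := by
    fun_prop
  simp only [div_eq_mul_inv]
  exact (he.fun_mul (hl i)).fun_mul ((hD i).fun_inv (hne i))

theorem pdMu_Afun {n : ℕ} (α x : ℝ) (w : (Fin n → ℝ) × (Fin n → ℝ)) (i : Fin n) :
    pdMu (Afun n α x) i w = 0 := by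
  rw [pdMu, ← (differentiable_Afun n α x w).lineDeriv_eq_fderiv, lineDeriv]
  simp [Afun]

theorem pdLam_Afun {n : ℕ} (α x : ℝ) (w : (Fin n → ℝ) × (Fin n → ℝ)) (i : Fin n) :
    pdLam (Afun n α x) i w = -lagr n α w i x := by
  rw [pdLam, ← (differentiable_Afun n α x w).lineDeriv_eq_fderiv, lineDeriv]
  have h (t : ℝ) : Afun n α x (w + t • (Pi.single i 1, 0)) =
      (x - w.1 i - t) * lagr n α w i x := by
    rw [Afun_eq_sub_mul_lagr _ _ _ i]
    congr 1
    · simp [sub_sub]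
    · unfold lagr
      congr 1
      refine Finset.prod_congr rfl fun j hj => ?_
      simp [Finset.ne_of_mem_erase hj]
  simp only [h]
  exact ((((hasDerivAt_id (0 : ℝ)).const_sub (x - w.1 i)).mul_const _).deriv).trans (by simp)

theorem pdMu_Bfun {n : ℕ} {α : ℝ} (β η x : ℝ) (hα : α ≠ 0)
    {w : (Fin n → ℝ) × (Fin n → ℝ)} (hw : w ∈ U n) (i : Fin n) :
    pdMu (Bfun n α β η x) i w =
      η * Real.exp (η * w.2 i) * lagr n α w i x / Ader n α w i := by
  rw [pdMu, ← (differentiableAt_Bfun β η x hα hw).lineDeriv_eq_fderiv, lineDeriv]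
  have h (t : ℝ) : Bfun n α β η x (w + t • (0, Pi.single i 1)) =
      β / α * Afun n α x w + ∑ j, Real.exp (η * (w.2 j + t * (Pi.single i 1 : Fin n → ℝ) j)) *
        lagr n α w j x / Ader n α w j := by
    simp [Bfun, Ader_eq_lagr, Afun, lagr]
  simp only [h]
  have hs (j : Fin n) : HasDerivAt
      (fun t : ℝ => Real.exp (η * (w.2 j + t * (Pi.single i 1 : Fin n → ℝ) j)) *
        lagr n α w j x / Ader n α w j)
      (Real.exp (η * w.2 j) * (η * (Pi.single i 1 : Fin n → ℝ) j) *
        lagr n α w j x / Ader n α w j) 0 := by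
    have h1 := (((hasDerivAt_id (0 : ℝ)).mul_const ((Pi.single i 1 : Fin n → ℝ) j)).const_add
      (w.2 j)).const_mul η
    simpa using (h1.exp.mul_const (lagr n α w j x)).div_const (Ader n α w j)
  refine ((HasDerivAt.fun_sum fun j _ => hs j).const_add _).deriv.trans ?_
  rw [Finset.sum_eq_single i (fun j _ hj => by simp [hj]) (by simp)]
  simp [mul_comm η]

/-!
STATEMENT 4: the Sklyanin-bracket relation
{B(x), A(y)}_0 = (η/(x−y))·(B(x)A(y) − B(y)A(x)) on U.
-/
theorem sklyanin_BA (n : ℕ) (hn : 1 ≤ n) (α β η : ℝ) (hα : α ≠ 0)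
    (x y : ℝ) (hxy : x ≠ y) (z : (Fin n → ℝ) × (Fin n → ℝ)) (hz : z ∈ U n) :
    bracket0 (fun w => Bfun n α β η x w) (fun w => Afun n α y w) z =
      η / (x - y) * (Bfun n α β η x z * Afun n α y z - Bfun n α β η y z * Afun n α x z) := by
  have hxy' : x - y ≠ 0 := sub_ne_zero.mpr hxy
  change ∑ i, (pdMu (Bfun n α β η x) i z * pdLam (Afun n α y) i z -
    pdLam (Bfun n α β η x) i z * pdMu (Afun n α y) i z) = _
  have hr : Bfun n α β η x z * Afun n α y z - Bfun n α β η y z * Afun n α x z =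
      ∑ i, Real.exp (η * z.2 i) / Ader n α z i *
        (lagr n α z i x * Afun n α y z - lagr n α z i y * Afun n α x z) := by
    have hs : ∀ u v, Bfun n α β η u z * Afun n α v z = β / α * Afun n α u z * Afun n α v z +
        ∑ i, Real.exp (η * z.2 i) / Ader n α z i * (lagr n α z i u * Afun n α v z) := by
      intro u v
      rw [Bfun, add_mul, Finset.sum_mul]
      congr 1
      exact Finset.sum_congr rfl fun i _ => by ring
    simp only [hs, mul_sub, Finset.sum_sub_distrib]
    ring
  rw [hr, Finset.mul_sum]
  refine Finset.sum_congr rfl fun i _ => ?_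
  rw [pdMu_Afun, pdLam_Afun, pdMu_Bfun β η x hα hz, Afun_eq_sub_mul_lagr α x z i,
    Afun_eq_sub_mul_lagr α y z i]
  have hne := Ader_ne_zero hα hz i
  field_simp
  ring

end
end

section
/- For every n ≥ 2 and all real constants a, b, the linear combination a{.,.}_0 + b{.,.}_1 of the canonical bracket and the second Toda bracket on ℝ^{2n} satisfies the Jacobi identity; in particular {.,.}_1 is a Poisson bracket compatible with the canonical bracket {.,.}_0 (the bi-Hamiltonian structure of the open Toda lattice). -/
noncomputable section

/-- Partial derivative of `F` with respect to `q_i` on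
`ℝ^{2n} = (Fin n → ℝ) × (Fin n → ℝ)`, coordinates `(q, p)`. -/
def pdQ {n : ℕ} (F : (Fin n → ℝ) × (Fin n → ℝ) → ℝ) (i : Fin n)
    (z : (Fin n → ℝ) × (Fin n → ℝ)) : ℝ :=
  fderiv ℝ F z (Pi.single i 1, 0)

/-- Partial derivative of `F` with respect to `p_i`. -/
def pdP {n : ℕ} (F : (Fin n → ℝ) × (Fin n → ℝ) → ℝ) (i : Fin n)
    (z : (Fin n → ℝ) × (Fin n → ℝ)) : ℝ :=
  fderiv ℝ F z (0, Pi.single i 1)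

/-- The canonical bracket `{F,G}_0 := Σ_i (∂F/∂q_i ∂G/∂p_i − ∂F/∂p_i ∂G/∂q_i)`. -/
def todaBr0 {n : ℕ} (F G : (Fin n → ℝ) × (Fin n → ℝ) → ℝ)
    (z : (Fin n → ℝ) × (Fin n → ℝ)) : ℝ :=
  ∑ i, (pdQ F i z * pdP G i z - pdP F i z * pdQ G i z)

/-- The second (open) Toda bracket
`{F,G}_1 := Σ_{i=1}^{n−1} e^{q_i−q_{i+1}} (∂F/∂p_{i+1} ∂G/∂p_i − ∂F/∂p_i ∂G/∂p_{i+1})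
 + Σ_i p_i (∂F/∂q_i ∂G/∂p_i − ∂F/∂p_i ∂G/∂q_i)
 + Σ_{i<j} (∂F/∂q_j ∂G/∂q_i − ∂F/∂q_i ∂G/∂q_j)`. -/
def todaBr1 {n : ℕ} (F G : (Fin n → ℝ) × (Fin n → ℝ) → ℝ)
    (z : (Fin n → ℝ) × (Fin n → ℝ)) : ℝ :=
  (∑ i : Fin n, ∑ j : Fin n, if (i : ℕ) + 1 = (j : ℕ) then
      Real.exp (z.1 i - z.1 j) * (pdP F j z * pdP G i z - pdP F i z * pdP G j z) else 0)
  + (∑ i : Fin n, z.2 i * (pdQ F i z * pdP G i z - pdP F i z * pdQ G i z))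
  + (∑ i : Fin n, ∑ j : Fin n, if i < j then
      (pdQ F j z * pdQ G i z - pdQ F i z * pdQ G j z) else 0)

/-- The pencil `a{.,.}_0 + b{.,.}_1`. -/
def todaPencil {n : ℕ} (a b : ℝ) (F G : (Fin n → ℝ) × (Fin n → ℝ) → ℝ)
    (z : (Fin n → ℝ) × (Fin n → ℝ)) : ℝ :=
  a * todaBr0 F G z + b * todaBr1 F G z

/-- Jacobi identity for the bracket `(F, G) ↦ dF (P dG)` of a skew tensor `P`, in terms of the
vanishing of the Schouten bracket `[P, P]`. -/
theorem jacobi_of_schouten {E : Type*} [NormedAddCommGroup E] [NormedSpace ℝ E]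
    {P : E → (E →L[ℝ] ℝ) →L[ℝ] E} {P' : E →L[ℝ] (E →L[ℝ] ℝ) →L[ℝ] E} {z : E}
    (hP : HasFDerivAt P P' z)
    (skew : ∀ α β : E →L[ℝ] ℝ, α (P z β) = -β (P z α))
    (schouten : ∀ α β γ : E →L[ℝ] ℝ,
      α (P' (P z γ) β) + β (P' (P z α) γ) + γ (P' (P z β) α) = 0)
    {F G H : E → ℝ} (hF : ContDiff ℝ 2 F) (hG : ContDiff ℝ 2 G) (hH : ContDiff ℝ 2 H) :
    fderiv ℝ (fun x => fderiv ℝ F x (P x (fderiv ℝ G x))) z (P z (fderiv ℝ H z))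
      + fderiv ℝ (fun x => fderiv ℝ G x (P x (fderiv ℝ H x))) z (P z (fderiv ℝ F z))
      + fderiv ℝ (fun x => fderiv ℝ H x (P x (fderiv ℝ F x))) z (P z (fderiv ℝ G z)) = 0 := by
  have hd : ∀ {F : E → ℝ}, ContDiff ℝ 2 F →
      HasFDerivAt (fderiv ℝ F) (fderiv ℝ (fderiv ℝ F) z) z := fun h =>
    ((h.fderiv_right (m := 1) (by norm_num)).differentiable (by norm_num) z).hasFDerivAt
  have hsymm : ∀ {F : E → ℝ}, ContDiff ℝ 2 F → ∀ v w,
      fderiv ℝ (fderiv ℝ F) z v w = fderiv ℝ (fderiv ℝ F) z w v := fun h v w =>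
    (h.contDiffAt.isSymmSndFDerivAt (by simp)).eq v w
  have key : ∀ {F G : E → ℝ}, ContDiff ℝ 2 F → ContDiff ℝ 2 G → ∀ v,
      fderiv ℝ (fun x => fderiv ℝ F x (P x (fderiv ℝ G x))) z v
        = fderiv ℝ (fderiv ℝ F) z v (P z (fderiv ℝ G z)) + fderiv ℝ F z (P' v (fderiv ℝ G z))
          - fderiv ℝ (fderiv ℝ G) z v (P z (fderiv ℝ F z)) := by
    intro F G hF hG v
    rw [((hd hF).clm_apply (hP.clm_apply (hd hG))).fderiv]
    have := skew (fderiv ℝ F z) (fderiv ℝ (fderiv ℝ G) z v)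
    simp [this]
    ring
  rw [key hF hG, key hG hH, key hH hF, hsymm hF (P z (fderiv ℝ H z)),
    hsymm hG (P z (fderiv ℝ F z)), hsymm hH (P z (fderiv ℝ G z))]
  linear_combination schouten (fderiv ℝ F z) (fderiv ℝ G z) (fderiv ℝ H z)

/-- The coordinate basis of `ℝ^{2n}`. -/
def phaseBasis {n : ℕ} : Fin n ⊕ Fin n → (Fin n → ℝ) × (Fin n → ℝ)
  | .inl i => (Pi.single i 1, 0)
  | .inr i => (0, Pi.single i 1)

/-- The brackets of the coordinate functions in the Toda pencil. -/
def todaCoeff {n : ℕ} (a b : ℝ) :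
    Fin n ⊕ Fin n → Fin n ⊕ Fin n → (Fin n → ℝ) × (Fin n → ℝ) → ℝ
  | .inl i, .inl j, _ => b * ((if j < i then 1 else 0) - if i < j then 1 else 0)
  | .inl i, .inr j, z => if i = j then a + b * z.2 i else 0
  | .inr i, .inl j, z => if i = j then -(a + b * z.2 i) else 0
  | .inr i, .inr j, z =>
    b * ((if (j : ℕ) + 1 = i then Real.exp (z.1 j - z.1 i) else 0)
      - if (i : ℕ) + 1 = j then Real.exp (z.1 i - z.1 j) else 0)

/-- The derivatives of `todaCoeff` at `z` along `v`. -/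
def todaCoeffDeriv {n : ℕ} (b : ℝ) (z v : (Fin n → ℝ) × (Fin n → ℝ)) :
    Fin n ⊕ Fin n → Fin n ⊕ Fin n → ℝ
  | .inl _, .inl _ => 0
  | .inl i, .inr j => if i = j then b * v.2 i else 0
  | .inr i, .inl j => if i = j then -(b * v.2 i) else 0
  | .inr i, .inr j =>
    b * ((if (j : ℕ) + 1 = i then Real.exp (z.1 j - z.1 i) * (v.1 j - v.1 i) else 0)
      - if (i : ℕ) + 1 = j then Real.exp (z.1 i - z.1 j) * (v.1 i - v.1 j) else 0)

theorem differentiable_todaCoeff {n : ℕ} (a b : ℝ) (k l : Fin n ⊕ Fin n) :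
    Differentiable ℝ (todaCoeff a b k l) := by
  rcases k with i | i <;> rcases l with j | j <;> unfold todaCoeff <;> dsimp only <;>
    split_ifs <;> fun_prop

theorem hasFDerivAt_position {n : ℕ} (i : Fin n) (z : (Fin n → ℝ) × (Fin n → ℝ)) :
    HasFDerivAt (fun z : (Fin n → ℝ) × (Fin n → ℝ) => z.1 i)
      (ContinuousLinearMap.proj (R := ℝ) (φ := fun _ => ℝ) i ∘L
        ContinuousLinearMap.fst ℝ (Fin n → ℝ) (Fin n → ℝ)) z :=
  ContinuousLinearMap.hasFDerivAt (ContinuousLinearMap.proj (R := ℝ) (φ := fun _ => ℝ) i ∘L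
    ContinuousLinearMap.fst ℝ (Fin n → ℝ) (Fin n → ℝ))

theorem hasFDerivAt_momentum {n : ℕ} (i : Fin n) (z : (Fin n → ℝ) × (Fin n → ℝ)) :
    HasFDerivAt (fun z : (Fin n → ℝ) × (Fin n → ℝ) => z.2 i)
      (ContinuousLinearMap.proj (R := ℝ) (φ := fun _ => ℝ) i ∘L
        ContinuousLinearMap.snd ℝ (Fin n → ℝ) (Fin n → ℝ)) z :=
  ContinuousLinearMap.hasFDerivAt (ContinuousLinearMap.proj (R := ℝ) (φ := fun _ => ℝ) i ∘L
    ContinuousLinearMap.snd ℝ (Fin n → ℝ) (Fin n → ℝ))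

theorem fderiv_todaCoeff {n : ℕ} (a b : ℝ) (k l : Fin n ⊕ Fin n)
    (z v : (Fin n → ℝ) × (Fin n → ℝ)) :
    fderiv ℝ (todaCoeff a b k l) z v = todaCoeffDeriv b z v k l := by
  have hp (i : Fin n) := ((hasFDerivAt_momentum i z).const_mul b).const_add a
  have hq (i j : Fin n) := ((hasFDerivAt_position i z).fun_sub (hasFDerivAt_position j z)).exp
  rcases k with i | i <;> rcases l with j | j <;> unfold todaCoeff todaCoeffDeriv <;>
    dsimp only
  · simp
  · split_ifs
    · simp [(hp i).fderiv]
    · simp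
  · split_ifs
    · rw [(hp i).fun_neg.fderiv]
      simp
    · simp
  · split_ifs
    · omega
    · simp [((hq j i).const_mul b).fderiv]
    · simp [((hq i j).const_mul b).fun_neg.fderiv]
    · simp

theorem todaCoeff_skew {n : ℕ} (a b : ℝ) (k l : Fin n ⊕ Fin n)
    (z : (Fin n → ℝ) × (Fin n → ℝ)) : todaCoeff a b k l z = -todaCoeff a b l k z := by
  rcases k with i | i <;> rcases l with j | j <;> simp only [todaCoeff]
  · ring
  · grind
  · grind
  · ring

/-- The Hamiltonian vector field of the `l`-th coordinate function. -/
def todaField {n : ℕ} (a b : ℝ) (l : Fin n ⊕ Fin n) (z : (Fin n → ℝ) × (Fin n → ℝ)) :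
    (Fin n → ℝ) × (Fin n → ℝ) :=
  (fun i => todaCoeff a b (.inl i) l z, fun i => todaCoeff a b (.inr i) l z)

theorem todaField_eq_sum {n : ℕ} (a b : ℝ) (l : Fin n ⊕ Fin n)
    (z : (Fin n → ℝ) × (Fin n → ℝ)) :
    todaField a b l z = ∑ k, todaCoeff a b k l z • phaseBasis k := by
  ext i <;> simp [todaField, phaseBasis, Fintype.sum_sum_type, Prod.fst_sum, Prod.snd_sum,
    Finset.sum_apply, Pi.single_apply]

theorem todaCoeff_jacobi {n : ℕ} (a b : ℝ) (k l m : Fin n ⊕ Fin n)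
    (z : (Fin n → ℝ) × (Fin n → ℝ)) :
    todaCoeffDeriv b z (todaField a b m z) k l + todaCoeffDeriv b z (todaField a b k z) l m
      + todaCoeffDeriv b z (todaField a b l z) m k = 0 := by
  rcases k with i | i <;> rcases l with j | j <;> rcases m with k | k <;>
    simp only [todaCoeffDeriv, todaField, todaCoeff]
  all_goals grind

section Tensor

variable {E ι : Type*} [NormedAddCommGroup E] [NormedSpace ℝ E] [Fintype ι]

/-- The tensor with components `c k l` in the family of vectors `e`, as a map from covectors to
vectors. -/
def tensorSharp (e : ι → E) (c : ι → ι → ℝ) : (E →L[ℝ] ℝ) →L[ℝ] E :=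
  ∑ k, ∑ l, c k l • (ContinuousLinearMap.apply ℝ ℝ (e l)).smulRight (e k)

theorem apply_tensorSharp (e : ι → E) (c : ι → ι → ℝ) (α β : E →L[ℝ] ℝ) :
    α (tensorSharp e c β) = ∑ k, ∑ l, c k l * (α (e k) * β (e l)) := by
  simp [tensorSharp, mul_comm]

theorem tensorSharp_apply (e : ι → E) (c : ι → ι → ℝ) (β : E →L[ℝ] ℝ) :
    tensorSharp e c β = ∑ l, β (e l) • ∑ k, c k l • e k := by
  simp only [Finset.smul_sum]
  rw [Finset.sum_comm]
  simp [tensorSharp, smul_smul, mul_comm]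

theorem tensorSharp_skew (e : ι → E) {c : ι → ι → ℝ} (hc : ∀ k l, c k l = -c l k)
    (α β : E →L[ℝ] ℝ) : α (tensorSharp e c β) = -β (tensorSharp e c α) := by
  rw [apply_tensorSharp, apply_tensorSharp, Finset.sum_comm]
  simp only [← Finset.sum_neg_distrib]
  refine Finset.sum_congr rfl fun k _ => Finset.sum_congr rfl fun l _ => ?_
  rw [hc l k]
  ring

theorem exists_hasFDerivAt_sum_smul {V : Type*} [NormedAddCommGroup V] [NormedSpace ℝ V]
    (w : ι → ι → V) {c : ι → ι → E → ℝ} {c' : ι → ι → E →L[ℝ] ℝ} {z : E}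
    (hc : ∀ k l, HasFDerivAt (c k l) (c' k l) z) :
    ∃ P' : E →L[ℝ] V, HasFDerivAt (fun x => ∑ k, ∑ l, c k l x • w k l) P' z ∧
      ∀ v, P' v = ∑ k, ∑ l, c' k l v • w k l :=
  ⟨∑ k, ∑ l, (c' k l).smulRight (w k l),
    HasFDerivAt.fun_sum fun k _ => HasFDerivAt.fun_sum fun l _ => (hc k l).smul_const _,
    fun v => by simp⟩

theorem exists_hasFDerivAt_tensorSharp (e : ι → E) {c : ι → ι → E → ℝ}
    {c' : ι → ι → E →L[ℝ] ℝ} {z : E} (hc : ∀ k l, HasFDerivAt (c k l) (c' k l) z) :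
    ∃ P' : E →L[ℝ] (E →L[ℝ] ℝ) →L[ℝ] E,
      HasFDerivAt (fun x => tensorSharp e fun k l => c k l x) P' z ∧
      ∀ v, P' v = tensorSharp e fun k l => c' k l v :=
  exists_hasFDerivAt_sum_smul (V := (E →L[ℝ] ℝ) →L[ℝ] E)
    (fun k l => (ContinuousLinearMap.apply ℝ ℝ (e l)).smulRight (e k)) hc

theorem apply_tensorSharp_deriv (e : ι → E) (c : ι → ι → ℝ) (c' : ι → ι → E →L[ℝ] ℝ)
    (α β γ : E →L[ℝ] ℝ) :
    α (tensorSharp e (fun k l => c' k l (tensorSharp e c γ)) β)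
      = ∑ k, ∑ l, ∑ m, α (e k) * β (e l) * γ (e m) * c' k l (∑ i, c i m • e i) := by
  rw [apply_tensorSharp]
  refine Finset.sum_congr rfl fun k _ => Finset.sum_congr rfl fun l _ => ?_
  rw [tensorSharp_apply, map_sum, Finset.sum_mul]
  refine Finset.sum_congr rfl fun m _ => ?_
  rw [map_smul, smul_eq_mul]
  ring

theorem tensorSharp_schouten (e : ι → E) {c : ι → ι → ℝ} {c' : ι → ι → E →L[ℝ] ℝ}
    (h : ∀ k l m, c' k l (∑ i, c i m • e i) + c' l m (∑ i, c i k • e i)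
      + c' m k (∑ i, c i l • e i) = 0) (α β γ : E →L[ℝ] ℝ) :
    α (tensorSharp e (fun k l => c' k l (tensorSharp e c γ)) β)
      + β (tensorSharp e (fun k l => c' k l (tensorSharp e c α)) γ)
      + γ (tensorSharp e (fun k l => c' k l (tensorSharp e c β)) α) = 0 := by
  have rot (f : ι → ι → ι → ℝ) : ∑ k, ∑ l, ∑ m, f k l m = ∑ k, ∑ l, ∑ m, f l m k :=
    (Finset.sum_congr rfl fun _ _ => Finset.sum_comm).trans Finset.sum_comm
  rw [apply_tensorSharp_deriv, apply_tensorSharp_deriv, apply_tensorSharp_deriv,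
    rot fun k l m => β (e k) * γ (e l) * α (e m) * c' k l (∑ i, c i m • e i),
    ← rot fun k l m => γ (e m) * α (e k) * β (e l) * c' m k (∑ i, c i l • e i)]
  simp only [← Finset.sum_add_distrib]
  refine Finset.sum_eq_zero fun k _ => Finset.sum_eq_zero fun l _ =>
    Finset.sum_eq_zero fun m _ => ?_
  linear_combination α (e k) * β (e l) * γ (e m) * h k l m

end Tensor

/-- The Poisson tensor of the Toda pencil, as a map from covectors to vectors. -/
def todaSharp {n : ℕ} (a b : ℝ) (z : (Fin n → ℝ) × (Fin n → ℝ)) :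
    ((Fin n → ℝ) × (Fin n → ℝ) →L[ℝ] ℝ) →L[ℝ] (Fin n → ℝ) × (Fin n → ℝ) :=
  tensorSharp phaseBasis fun k l => todaCoeff a b k l z

theorem todaPencil_eq {n : ℕ} (a b : ℝ) (F G : (Fin n → ℝ) × (Fin n → ℝ) → ℝ) :
    todaPencil a b F G = fun z => fderiv ℝ F z (todaSharp a b z (fderiv ℝ G z)) := by
  funext z
  have hQ (F : (Fin n → ℝ) × (Fin n → ℝ) → ℝ) (i : Fin n) :
      fderiv ℝ F z (phaseBasis (.inl i)) = pdQ F i z := rfl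
  have hP (F : (Fin n → ℝ) × (Fin n → ℝ) → ℝ) (i : Fin n) :
      fderiv ℝ F z (phaseBasis (.inr i)) = pdP F i z := rfl
  have split (p : Fin n → Fin n → Prop) [∀ i j, Decidable (p i j)] (f g : Fin n → Fin n → ℝ) :
      ∑ i, ∑ j, (if p i j then f j i - g i j else 0)
        = ∑ i, ∑ j, ((if p j i then f i j else 0) - if p i j then g i j else 0) := by
    simp only [Finset.sum_sub_distrib]
    rw [Finset.sum_comm (f := fun i j => if p j i then f i j else 0)]
    simp only [← Finset.sum_sub_distrib]
    refine Finset.sum_congr rfl fun i _ => Finset.sum_congr rfl fun j _ => ?_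
    split_ifs <;> simp
  simp only [todaSharp, apply_tensorSharp, Fintype.sum_sum_type, hQ, hP, todaCoeff, ite_mul, zero_mul,
    Finset.sum_add_distrib, Finset.sum_ite_eq, Finset.mem_univ, if_true]
  have hexp := split (fun i j => (i : ℕ) + 1 = j)
    (fun i j => Real.exp (z.1 j - z.1 i) * (pdP F i z * pdP G j z))
    (fun i j => Real.exp (z.1 i - z.1 j) * (pdP F i z * pdP G j z))
  have hord := split (fun i j => i < j) (fun i j => pdQ F i z * pdQ G j z)
    (fun i j => pdQ F i z * pdQ G j z)
  simp only [← mul_sub] at hexp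
  simp only [todaPencil, todaBr0, todaBr1, hexp, hord, mul_add, Finset.mul_sum]
  simp only [← Finset.sum_add_distrib]
  refine Finset.sum_congr rfl fun i _ => ?_
  simp only [mul_assoc, sub_mul, ite_mul, one_mul, zero_mul]
  ring

/-!
STATEMENT 9: for every n ≥ 2 and all a, b ∈ ℝ, the linear combination
a{.,.}_0 + b{.,.}_1 satisfies the Jacobi identity; in particular {.,.}_1 is a
Poisson bracket compatible with {.,.}_0 (bi-Hamiltonian structure of the open Toda lattice).
-/
theorem toda_pencil_jacobi (n : ℕ) (hn : 2 ≤ n) (a b : ℝ)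
    (F G H : (Fin n → ℝ) × (Fin n → ℝ) → ℝ)
    (hF : ContDiff ℝ (⊤ : ℕ∞) F) (hG : ContDiff ℝ (⊤ : ℕ∞) G) (hH : ContDiff ℝ (⊤ : ℕ∞) H) :
    ∀ z, todaPencil a b (todaPencil a b F G) H z
      + todaPencil a b (todaPencil a b G H) F z
      + todaPencil a b (todaPencil a b H F) G z = 0 := by
  intro z
  have h2 {F : (Fin n → ℝ) × (Fin n → ℝ) → ℝ} (h : ContDiff ℝ (⊤ : ℕ∞) F) : ContDiff ℝ 2 F :=
    contDiff_infty.mp h 2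
  simp only [todaPencil_eq]
  obtain ⟨P', hP', hP'_apply⟩ := exists_hasFDerivAt_tensorSharp phaseBasis
    fun k l => (differentiable_todaCoeff a b k l z).hasFDerivAt
  refine jacobi_of_schouten hP' (tensorSharp_skew _ fun k l => todaCoeff_skew a b k l z)
    (fun α β γ => ?_) (h2 hF) (h2 hG) (h2 hH)
  simp only [hP'_apply]
  refine tensorSharp_schouten _ (fun k l m => ?_) α β γ
  simp only [← todaField_eq_sum, fderiv_todaCoeff]
  exact todaCoeff_jacobi a b k l m z

end
end

section
/- The open Toda flow is bi-Hamiltonian: for every smooth function G on ℝ^{2n}, {Σ_{k=1}^n p_k, G}_1 = {H, G}_0, where H := (1/2)Σ_{i=1}^n p_i^2 + Σ_{i=1}^{n−1} e^{q_i−q_{i+1}}; i.e., the Hamiltonian vector field of H with respect to the canonical bracket equals the Hamiltonian vector field of the total momentum Σp_k with respect to the second Toda bracket. -/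
noncomputable section

/-- The derivative of the total momentum. -/
theorem hasFDerivAt_totalMomentum {n : ℕ} (z : (Fin n → ℝ) × (Fin n → ℝ)) :
    HasFDerivAt (fun w : (Fin n → ℝ) × (Fin n → ℝ) => ∑ k, w.2 k)
      (∑ k, (ContinuousLinearMap.proj k).comp
        (ContinuousLinearMap.snd ℝ (Fin n → ℝ) (Fin n → ℝ))) z :=
  HasFDerivAt.fun_sum fun k _ => ((ContinuousLinearMap.proj k).comp
    (ContinuousLinearMap.snd ℝ (Fin n → ℝ) (Fin n → ℝ))).hasFDerivAt

theorem pdQ_totalMomentum {n : ℕ} (i : Fin n) (z : (Fin n → ℝ) × (Fin n → ℝ)) :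
    pdQ (fun w => ∑ k, w.2 k) i z = 0 := by
  simp [pdQ, (hasFDerivAt_totalMomentum z).fderiv]

theorem pdP_totalMomentum {n : ℕ} (i : Fin n) (z : (Fin n → ℝ) × (Fin n → ℝ)) :
    pdP (fun w => ∑ k, w.2 k) i z = 1 := by
  simp [pdP, (hasFDerivAt_totalMomentum z).fderiv]

/-- The directional derivatives of the open Toda Hamiltonian. -/
theorem fderiv_todaHamiltonian_apply {n : ℕ} (z v : (Fin n → ℝ) × (Fin n → ℝ)) :
    fderiv ℝ (fun w : (Fin n → ℝ) × (Fin n → ℝ) => (1 / 2) * ∑ i, (w.2 i) ^ 2 +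
        ∑ i : Fin n, ∑ j : Fin n,
          if (i : ℕ) + 1 = (j : ℕ) then Real.exp (w.1 i - w.1 j) else 0) z v =
      ∑ i, z.2 i * v.2 i + ∑ i : Fin n, ∑ j : Fin n,
        if (i : ℕ) + 1 = (j : ℕ) then Real.exp (z.1 i - z.1 j) * (v.1 i - v.1 j) else 0 := by
  have hq (i : Fin n) := ((ContinuousLinearMap.proj (R := ℝ) (φ := fun _ => ℝ) i).comp
    (ContinuousLinearMap.fst ℝ (Fin n → ℝ) (Fin n → ℝ))).hasFDerivAt (x := z)
  have hp (i : Fin n) := ((ContinuousLinearMap.proj (R := ℝ) (φ := fun _ => ℝ) i).comp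
    (ContinuousLinearMap.snd ℝ (Fin n → ℝ) (Fin n → ℝ))).hasFDerivAt (x := z)
  have hkin := (HasFDerivAt.fun_sum (u := Finset.univ) fun i _ => (hp i).pow 2).const_mul (1 / 2)
  have hpot := HasFDerivAt.fun_sum (u := Finset.univ) fun i _ =>
    HasFDerivAt.fun_sum (u := Finset.univ) fun j _ =>
      ((hq i).sub (hq j)).exp.const_mul (if (i : ℕ) + 1 = (j : ℕ) then 1 else 0)
  have key := (hkin.add hpot).fderiv
  have hfun : (fun w : (Fin n → ℝ) × (Fin n → ℝ) => (1 / 2) * ∑ i, (w.2 i) ^ 2 +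
        ∑ i : Fin n, ∑ j : Fin n,
          if (i : ℕ) + 1 = (j : ℕ) then Real.exp (w.1 i - w.1 j) else 0) =
      fun w => (1 / 2) * ∑ i, (w.2 i) ^ 2 + ∑ i : Fin n, ∑ j : Fin n,
        (if (i : ℕ) + 1 = (j : ℕ) then 1 else 0) * Real.exp (w.1 i - w.1 j) := by
    simp only [ite_mul, one_mul, zero_mul]
  rw [hfun]
  refine (DFunLike.congr_fun key v).trans ?_
  simp [Finset.mul_sum, mul_assoc]
  refine Finset.sum_congr rfl fun i _ => Finset.sum_congr rfl fun j _ => ?_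
  split_ifs <;> simp

theorem pdP_todaHamiltonian {n : ℕ} (i : Fin n) (z : (Fin n → ℝ) × (Fin n → ℝ)) :
    pdP (fun w => (1 / 2) * ∑ i, (w.2 i) ^ 2 +
        ∑ i : Fin n, ∑ j : Fin n,
          if (i : ℕ) + 1 = (j : ℕ) then Real.exp (w.1 i - w.1 j) else 0) i z = z.2 i := by
  rw [pdP, fderiv_todaHamiltonian_apply]
  simp [Pi.single_apply]

/-- Contracting the `q`-gradient of the open Toda Hamiltonian with a vector `a`. -/
theorem sum_pdQ_todaHamiltonian_mul {n : ℕ} (z : (Fin n → ℝ) × (Fin n → ℝ)) (a : Fin n → ℝ) :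
    ∑ k, pdQ (fun w => (1 / 2) * ∑ i, (w.2 i) ^ 2 +
        ∑ i : Fin n, ∑ j : Fin n,
          if (i : ℕ) + 1 = (j : ℕ) then Real.exp (w.1 i - w.1 j) else 0) k z * a k =
      ∑ i : Fin n, ∑ j : Fin n,
        if (i : ℕ) + 1 = (j : ℕ) then Real.exp (z.1 i - z.1 j) * (a i - a j) else 0 := by
  simp only [pdQ, fderiv_todaHamiltonian_apply, Finset.sum_mul, Pi.zero_apply, mul_zero,
    Finset.sum_const_zero, zero_add]
  rw [Finset.sum_comm]
  refine Finset.sum_congr rfl fun i _ => ?_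
  rw [Finset.sum_comm]
  refine Finset.sum_congr rfl fun j _ => ?_
  split_ifs
  · simp [mul_assoc, ← Finset.mul_sum, sub_mul, Pi.single_apply]
  · simp

/-!
STATEMENT 10: the open Toda flow is bi-Hamiltonian: for every smooth G,
{Σ_k p_k, G}_1 = {H, G}_0 with H = (1/2)Σ p_i² + Σ_{i=1}^{n−1} e^{q_i−q_{i+1}}.
-/
theorem toda_biHamiltonian (n : ℕ) (hn : 2 ≤ n)
    (G : (Fin n → ℝ) × (Fin n → ℝ) → ℝ) (hG : ContDiff ℝ (⊤ : ℕ∞) G) :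
    ∀ z, todaBr1 (fun w => ∑ k, w.2 k) G z =
      todaBr0 (fun w => (1 / 2) * ∑ i, (w.2 i) ^ 2 +
        ∑ i : Fin n, ∑ j : Fin n,
          if (i : ℕ) + 1 = (j : ℕ) then Real.exp (w.1 i - w.1 j) else 0) G z := by
  intro z
  simp only [todaBr1, todaBr0, pdQ_totalMomentum, pdP_totalMomentum, pdP_todaHamiltonian,
    Finset.sum_sub_distrib, sum_pdQ_todaHamiltonian_mul]
  simp [sub_eq_add_neg]

end
end

section
/- The first two integrals of the open Toda lattice, H_1^o := −Σ_{i=1}^n p_i and H_2^o := (1/2)Σ_{i=1}^n p_i^2 + Σ_{i=1}^{n−1} e^{q_i−q_{i+1}} − (1/2)(Σ_{i=1}^n p_i)^2, are in bi-involution: {H_1^o, H_2^o}_0 = 0 and {H_1^o, H_2^o}_1 = 0. -/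
noncomputable section

/-- Pairing the `q`-gradient with a vector gives the directional derivative. -/
theorem sum_mul_pdQ {n : ℕ} (F : (Fin n → ℝ) × (Fin n → ℝ) → ℝ) (c : Fin n → ℝ)
    (z : (Fin n → ℝ) × (Fin n → ℝ)) :
    ∑ k, c k * pdQ F k z = fderiv ℝ F z (c, 0) := by
  have h := LinearMap.pi_apply_eq_sum_univ
    ((fderiv ℝ F z).comp (ContinuousLinearMap.inl ℝ (Fin n → ℝ) (Fin n → ℝ))).toLinearMap c
  simp only [ContinuousLinearMap.coe_coe, ContinuousLinearMap.comp_apply,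
    ContinuousLinearMap.inl_apply, smul_eq_mul] at h
  rw [h]
  refine Finset.sum_congr rfl fun k _ => ?_
  rw [pdQ]
  congr 4
  ext j
  simp [Pi.single_apply, eq_comm]

theorem fderiv_neg_sum_momenta {n : ℕ} (z v : (Fin n → ℝ) × (Fin n → ℝ)) :
    fderiv ℝ (fun w : (Fin n → ℝ) × (Fin n → ℝ) => -∑ i, w.2 i) z v = -∑ i, v.2 i := by
  have h : HasLineDerivAt ℝ (fun w : (Fin n → ℝ) × (Fin n → ℝ) => -∑ i, w.2 i)
      (-∑ i, v.2 i) z v := by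
    have hp (i : Fin n) : HasDerivAt (fun t : ℝ => z.2 i + t * v.2 i) (v.2 i) 0 := by
      simpa using ((hasDerivAt_id (0 : ℝ)).mul_const (v.2 i)).const_add (z.2 i)
    exact (HasDerivAt.fun_sum fun i _ => hp i).fun_neg
  have hd : DifferentiableAt ℝ (fun w : (Fin n → ℝ) × (Fin n → ℝ) => -∑ i, w.2 i) z := by
    fun_prop
  rw [← hd.lineDeriv_eq_fderiv, h.lineDeriv]

theorem fderiv_toda_hamiltonian {n : ℕ} (z v : (Fin n → ℝ) × (Fin n → ℝ)) :
    fderiv ℝ (fun w : (Fin n → ℝ) × (Fin n → ℝ) => (1 / 2) * ∑ i, (w.2 i) ^ 2 +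
      (∑ i : Fin n, ∑ j : Fin n,
        if (i : ℕ) + 1 = (j : ℕ) then Real.exp (w.1 i - w.1 j) else 0) -
      (1 / 2) * (∑ i, w.2 i) ^ 2) z v =
    ∑ i, z.2 i * v.2 i +
      (∑ i : Fin n, ∑ j : Fin n,
        if (i : ℕ) + 1 = (j : ℕ) then Real.exp (z.1 i - z.1 j) * (v.1 i - v.1 j) else 0) -
      (∑ i, z.2 i) * ∑ i, v.2 i := by
  have hq (i : Fin n) : HasDerivAt (fun t : ℝ => z.1 i + t * v.1 i) (v.1 i) 0 := by
    simpa using ((hasDerivAt_id (0 : ℝ)).mul_const (v.1 i)).const_add (z.1 i)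
  have hp (i : Fin n) : HasDerivAt (fun t : ℝ => z.2 i + t * v.2 i) (v.2 i) 0 := by
    simpa using ((hasDerivAt_id (0 : ℝ)).mul_const (v.2 i)).const_add (z.2 i)
  have hexp (i j : Fin n) : HasDerivAt
      (fun t : ℝ => if (i : ℕ) + 1 = (j : ℕ) then
        Real.exp ((z.1 i + t * v.1 i) - (z.1 j + t * v.1 j)) else 0)
      (if (i : ℕ) + 1 = (j : ℕ) then Real.exp (z.1 i - z.1 j) * (v.1 i - v.1 j) else 0) 0 := by
    split_ifs
    · simpa using ((hq i).fun_sub (hq j)).exp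
    · exact hasDerivAt_const _ _
  have h := (((HasDerivAt.fun_sum (u := Finset.univ) fun i _ => (hp i).fun_pow 2).const_mul
    (1 / 2 : ℝ)).fun_add
      (HasDerivAt.fun_sum (u := Finset.univ) fun i _ =>
        HasDerivAt.fun_sum (u := Finset.univ) fun j _ => hexp i j)).fun_sub
    (((HasDerivAt.fun_sum (u := Finset.univ) fun i _ => hp i).fun_pow 2).const_mul (1 / 2 : ℝ))
  have hd : DifferentiableAt ℝ (fun w : (Fin n → ℝ) × (Fin n → ℝ) =>
      (1 / 2) * ∑ i, (w.2 i) ^ 2 +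
      (∑ i : Fin n, ∑ j : Fin n,
        if (i : ℕ) + 1 = (j : ℕ) then Real.exp (w.1 i - w.1 j) else 0) -
      (1 / 2) * (∑ i, w.2 i) ^ 2) z := by
    have he (i j : Fin n) : DifferentiableAt ℝ (fun w : (Fin n → ℝ) × (Fin n → ℝ) =>
        if (i : ℕ) + 1 = (j : ℕ) then Real.exp (w.1 i - w.1 j) else 0) z := by
      split_ifs <;> fun_prop
    fun_prop
  rw [← hd.lineDeriv_eq_fderiv]
  refine HasDerivAt.deriv (h.congr_deriv ?_)
  have hsq : ∑ i, 2 * z.2 i * v.2 i = 2 * ∑ i, z.2 i * v.2 i := by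
    rw [Finset.mul_sum]
    exact Finset.sum_congr rfl fun i _ => by ring
  simp only [Nat.cast_ofNat, Nat.add_one_sub_one, pow_one, zero_mul, add_zero, hsq]
  ring

/-!
STATEMENT 11: the first two open Toda integrals
H₁ᵒ = −Σ p_i and H₂ᵒ = (1/2)Σ p_i² + Σ_{i=1}^{n−1} e^{q_i−q_{i+1}} − (1/2)(Σ p_i)²
are in bi-involution: {H₁ᵒ,H₂ᵒ}_0 = 0 and {H₁ᵒ,H₂ᵒ}_1 = 0.
-/
theorem toda_bi_involution (n : ℕ) (hn : 2 ≤ n)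
    (H1 H2 : (Fin n → ℝ) × (Fin n → ℝ) → ℝ)
    (hH1 : H1 = fun w => -∑ i, w.2 i)
    (hH2 : H2 = fun w => (1 / 2) * ∑ i, (w.2 i) ^ 2 +
      (∑ i : Fin n, ∑ j : Fin n,
        if (i : ℕ) + 1 = (j : ℕ) then Real.exp (w.1 i - w.1 j) else 0) -
      (1 / 2) * (∑ i, w.2 i) ^ 2) :
    (∀ z, todaBr0 H1 H2 z = 0) ∧ (∀ z, todaBr1 H1 H2 z = 0) := by
  have hQ1 (k : Fin n) (z) : pdQ H1 k z = 0 := by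
    rw [pdQ, hH1, fderiv_neg_sum_momenta]
    simp
  have hP1 (k : Fin n) (z) : pdP H1 k z = -1 := by
    rw [pdP, hH1, fderiv_neg_sum_momenta]
    simp
  have hP2 (k : Fin n) (z) : pdP H2 k z = z.2 k - ∑ i, z.2 i := by
    rw [pdP, hH2, fderiv_toda_hamiltonian]
    simp [Pi.single_apply]
  have hQ2 (c : Fin n → ℝ) (z) : ∑ k, c k * pdQ H2 k z = ∑ i : Fin n, ∑ j : Fin n,
      if (i : ℕ) + 1 = (j : ℕ) then Real.exp (z.1 i - z.1 j) * (c i - c j) else 0 := by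
    rw [sum_mul_pdQ, hH2, fderiv_toda_hamiltonian]
    simp
  refine ⟨fun z => ?_, fun z => ?_⟩
  · have h := hQ2 (fun _ => 1) z
    simpa [todaBr0, hQ1, hP1] using h
  · simp only [todaBr1, hQ1, hP1, hP2, zero_mul, zero_sub, neg_mul, one_mul, neg_neg, sub_self,
      ite_self, Finset.sum_const_zero, add_zero]
    rw [hQ2, ← Finset.sum_add_distrib]
    refine Finset.sum_eq_zero fun i _ => ?_
    rw [← Finset.sum_add_distrib]
    refine Finset.sum_eq_zero fun j _ => ?_
    split_ifs <;> ring

end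
end

section
/- For the integrable DST model with n degrees of freedom, the first two integrals H_1 := −Σ_{i=1}^n(q_i p_i − c_i) and H_2 := Σ_{1≤j<i≤n}(q_i p_i − c_i)(q_j p_j − c_j) − b·Σ_{i=1}^n q_i p_{i+1} (with p_{n+1} ≡ p_1) are in involution with respect to the canonical bracket: {H_1, H_2}_0 = 0. -/
noncomputable section

/-- The bracket with `-∑ i, (q i * p i - c i)` is the derivative along the generator `(q, -p)` of the
scaling flow `(exp t • q, exp (-t) • p)`. -/
theorem todaBr0_neg_sum_mul {n : ℕ} (c : Fin n → ℝ) (G : (Fin n → ℝ) × (Fin n → ℝ) → ℝ)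
    (z : (Fin n → ℝ) × (Fin n → ℝ)) :
    todaBr0 (fun w => -∑ i, (w.1 i * w.2 i - c i)) G z = fderiv ℝ G z (z.1, -z.2) := by
  have hF : HasFDerivAt
      (fun w : (Fin n → ℝ) × (Fin n → ℝ) => -∑ i, (w.1 i * w.2 i - c i))
      (-∑ i, (z.1 i • (ContinuousLinearMap.proj (R := ℝ) (φ := fun _ : Fin n => ℝ) i ∘L
          ContinuousLinearMap.snd ℝ (Fin n → ℝ) (Fin n → ℝ))
        + z.2 i • (ContinuousLinearMap.proj (R := ℝ) (φ := fun _ : Fin n => ℝ) i ∘L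
          ContinuousLinearMap.fst ℝ (Fin n → ℝ) (Fin n → ℝ)))) z := by
    refine (HasFDerivAt.fun_sum fun i _ => ?_).fun_neg
    refine HasFDerivAt.sub_const (c i) ?_
    exact HasFDerivAt.mul
      (ContinuousLinearMap.proj (R := ℝ) (φ := fun _ : Fin n => ℝ) i ∘L
        ContinuousLinearMap.fst ℝ (Fin n → ℝ) (Fin n → ℝ)).hasFDerivAt
      (ContinuousLinearMap.proj (R := ℝ) (φ := fun _ : Fin n => ℝ) i ∘L
        ContinuousLinearMap.snd ℝ (Fin n → ℝ) (Fin n → ℝ)).hasFDerivAt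
  have hv : (z.1, -z.2) = ∑ i, (z.1 i • ((Pi.single i 1, 0) : (Fin n → ℝ) × (Fin n → ℝ))
      - z.2 i • ((0, Pi.single i 1) : (Fin n → ℝ) × (Fin n → ℝ))) := by
    ext k <;> simp [Prod.fst_sum, Prod.snd_sum, Finset.sum_apply, Pi.single_apply]
  rw [hv, map_sum]
  refine Finset.sum_congr rfl fun i _ => ?_
  rw [pdQ, pdP, pdP, pdQ, hF.fderiv, map_sub, map_smul, map_smul]
  simp [Pi.single_apply]
  ring

/-- A function invariant under `(q, p) ↦ (exp t • q, exp (-t) • p)` has zero derivative along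
`(q, -p)`. -/
theorem fderiv_eq_zero_of_scaling_invariant {n : ℕ} {G : (Fin n → ℝ) × (Fin n → ℝ) → ℝ}
    {z : (Fin n → ℝ) × (Fin n → ℝ)} (hG : DifferentiableAt ℝ G z)
    (hinv : ∀ t : ℝ, G (Real.exp t • z.1, Real.exp (-t) • z.2) = G z) :
    fderiv ℝ G z (z.1, -z.2) = 0 := by
  have hγ : HasDerivAt (fun t : ℝ => (Real.exp t • z.1, Real.exp (-t) • z.2))
      (z.1, -z.2) 0 := by
    have h1 : HasDerivAt (fun t : ℝ => Real.exp t • z.1) z.1 0 := by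
      simpa using (Real.hasDerivAt_exp 0).smul_const z.1
    have h2 : HasDerivAt (fun t : ℝ => Real.exp (-t) • z.2) (-z.2) 0 := by
      simpa using (hasDerivAt_neg (0 : ℝ)).exp.smul_const z.2
    exact h1.prodMk h2
  have h := hG.hasFDerivAt.comp_hasDerivAt_of_eq (0 : ℝ) hγ (by simp)
  have hconst : G ∘ (fun t : ℝ => (Real.exp t • z.1, Real.exp (-t) • z.2)) = fun _ => G z :=
    funext hinv
  rw [hconst] at h
  exact h.unique (hasDerivAt_const 0 (G z))

/-!
STATEMENT 15: for the integrable DST model, H₁ = −Σ(q_i p_i − c_i) and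
H₂ = Σ_{j<i}(q_i p_i − c_i)(q_j p_j − c_j) − b Σ q_i p_{i+1} (p_{n+1} ≡ p_1)
are in involution with respect to the canonical bracket.
-/
theorem dst_involution (n : ℕ) (hn : 2 ≤ n) (b : ℝ) (c : Fin n → ℝ)
    (H1 H2 : (Fin n → ℝ) × (Fin n → ℝ) → ℝ)
    (hH1 : H1 = fun w => -∑ i, (w.1 i * w.2 i - c i))
    (hH2 : H2 = fun w =>
      (∑ i : Fin n, ∑ j : Fin n, if j < i then
        (w.1 i * w.2 i - c i) * (w.1 j * w.2 j - c j) else 0)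
      - b * ∑ i : Fin n, w.1 i * w.2 (⟨((i : ℕ) + 1) % n, Nat.mod_lt _ (by omega)⟩ : Fin n)) :
    ∀ z, todaBr0 H1 H2 z = 0 := by
  subst hH1 hH2
  intro z
  rw [todaBr0_neg_sum_mul]
  apply fderiv_eq_zero_of_scaling_invariant
  · refine DifferentiableAt.fun_sub (DifferentiableAt.fun_sum fun i _ =>
      DifferentiableAt.fun_sum fun j _ => ?_) (by fun_prop)
    split_ifs <;> fun_prop
  · intro t
    have h (x y : ℝ) : Real.exp t * x * (Real.exp (-t) * y) = x * y := by
      rw [mul_mul_mul_comm, ← Real.exp_add, add_neg_cancel, Real.exp_zero, one_mul]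
    simp only [Pi.smul_apply, smul_eq_mul, h]

end
end

section
/- For the n-site Heisenberg XXX magnet, the first two integrals H_1^o := Σ_{m=1}^n(c_m − s_3^{(m)}) and H_2^o := Σ_{1≤ℓ<m≤n}(s_1^{(m)} − i s_2^{(m)})(s_1^{(ℓ)} + i s_2^{(ℓ)}) − (1/2)Σ_{m=1}^n(c_m − s_3^{(m)})^2 + (1/2)(H_1^o)^2 are in involution with respect to the sl(2)^{⊕n} Lie–Poisson bracket: {H_1^o, H_2^o}_0 = 0. -/
/-!
STATEMENT 16: for the n-site Heisenberg XXX magnet, the integrals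
H₁ᵒ = Σ_m (c_m − s₃⁽ᵐ⁾) and
H₂ᵒ = Σ_{ℓ<m} (s₁⁽ᵐ⁾ − i s₂⁽ᵐ⁾)(s₁⁽ˡ⁾ + i s₂⁽ˡ⁾) − ½ Σ_m (c_m − s₃⁽ᵐ⁾)² + ½ (H₁ᵒ)²
are in involution with respect to the sl(2)^{⊕n} Lie–Poisson bracket.
-/

noncomputable section

/-- Partial derivative of `F : ℂ^{3n} → ℂ` with respect to `s_i^{(m)}`; the phase space is
`Fin n → Fin 3 → ℂ` with `s^{(m)} = (s_1^{(m)}, s_2^{(m)}, s_3^{(m)})` indexed by `Fin 3`. -/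
def pdS {n : ℕ} (F : (Fin n → Fin 3 → ℂ) → ℂ) (m : Fin n) (i : Fin 3)
    (s : Fin n → Fin 3 → ℂ) : ℂ :=
  fderiv ℂ F s (Pi.single m (Pi.single i 1))

/-- The totally antisymmetric symbol `ε` on `Fin 3` with `ε₀₁₂ = 1` (indices `0,1,2`
standing for `1,2,3`). -/
def eps3 (i j k : Fin 3) : ℂ :=
  if (i, j, k) = (0, 1, 2) ∨ (i, j, k) = (1, 2, 0) ∨ (i, j, k) = (2, 0, 1) then 1
  else if (i, j, k) = (2, 1, 0) ∨ (i, j, k) = (0, 2, 1) ∨ (i, j, k) = (1, 0, 2) then -1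
  else 0

/-- The Lie–Poisson bracket of `sl(2)^{⊕n}`, the biderivation determined by
`{s_i^{(m)}, s_j^{(ℓ)}}_0 = δ_{mℓ} ε_{ijk} s_k^{(m)}`:
`{F,G}_0(s) = Σ_m Σ_{i,j,k} ε_{ijk} s_k^{(m)} ∂F/∂s_i^{(m)} ∂G/∂s_j^{(m)}`. -/
def sl2Bracket {n : ℕ} (F G : (Fin n → Fin 3 → ℂ) → ℂ) (s : Fin n → Fin 3 → ℂ) : ℂ :=
  ∑ m : Fin n, ∑ i : Fin 3, ∑ j : Fin 3, ∑ k : Fin 3,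
    eps3 i j k * s m k * (pdS F m i s * pdS G m j s)

/-- The infinitesimal simultaneous rotation of all spins about the third axis. -/
def rotationField {n : ℕ} (s : Fin n → Fin 3 → ℂ) : Fin n → Fin 3 → ℂ :=
  fun m => ![-s m 1, s m 0, 0]

lemma pdS_sum_sub_third {n : ℕ} (c : Fin n → ℂ) (m : Fin n) (i : Fin 3)
    (s : Fin n → Fin 3 → ℂ) :
    pdS (fun s : Fin n → Fin 3 → ℂ => ∑ l, (c l - s l 2)) m i s = if i = 2 then -1 else 0 := by
  have h : HasFDerivAt (fun s : Fin n → Fin 3 → ℂ => ∑ l, (c l - s l 2))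
      (∑ l : Fin n, -((ContinuousLinearMap.proj (R := ℂ) (φ := fun _ : Fin 3 => ℂ) 2).comp
        (ContinuousLinearMap.proj (R := ℂ) (φ := fun _ : Fin n => Fin 3 → ℂ) l))) s := by
    refine HasFDerivAt.fun_sum fun l _ => ?_
    exact (((ContinuousLinearMap.proj (R := ℂ) (φ := fun _ : Fin 3 => ℂ) 2).comp
      (ContinuousLinearMap.proj (R := ℂ) (φ := fun _ : Fin n => Fin 3 → ℂ) l)).hasFDerivAt).const_sub
        (c l)
  rw [pdS, h.fderiv, sum_apply, Finset.sum_eq_single m]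
  · fin_cases i <;> simp
  · intro l _ hl
    simp [Pi.single_eq_of_ne hl]
  · simp

lemma rotationField_eq_sum {n : ℕ} (s : Fin n → Fin 3 → ℂ) :
    rotationField s = ∑ m, (s m 0 • (Pi.single m (Pi.single 1 1) : Fin n → Fin 3 → ℂ)
      - s m 1 • (Pi.single m (Pi.single 0 1) : Fin n → Fin 3 → ℂ)) := by
  ext l i
  rw [Finset.sum_apply, Finset.sum_apply, Finset.sum_eq_single l]
  · fin_cases i <;> simp [rotationField]
  · intro m _ hm
    simp [Pi.single_eq_of_ne hm.symm]
  · simp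

/-- The total third spin component generates the simultaneous rotation about the third axis. -/
lemma sl2Bracket_sum_sub_third {n : ℕ} (c : Fin n → ℂ) (G : (Fin n → Fin 3 → ℂ) → ℂ)
    (s : Fin n → Fin 3 → ℂ) :
    sl2Bracket (fun s => ∑ l, (c l - s l 2)) G s = fderiv ℂ G s (rotationField s) := by
  rw [rotationField_eq_sum, map_sum]
  refine Finset.sum_congr rfl fun m _ => ?_
  simp only [pdS_sum_sub_third, map_sub, map_smul, Fin.sum_univ_three]
  simp [eps3, pdS]
  ring

/-- `{H₁ᵒ, H₂ᵒ}_0 = 0` for the Heisenberg magnet. -/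
theorem heisenberg_involution (n : ℕ) (hn : 1 ≤ n) (c : Fin n → ℂ)
    (H1 H2 : (Fin n → Fin 3 → ℂ) → ℂ)
    (hH1 : H1 = fun s => ∑ m, (c m - s m 2))
    (hH2 : H2 = fun s =>
      (∑ m : Fin n, ∑ l : Fin n, if l < m then
        (s m 0 - Complex.I * s m 1) * (s l 0 + Complex.I * s l 1) else 0)
      - (1 / 2) * ∑ m, (c m - s m 2) ^ 2 + (1 / 2) * (H1 s) ^ 2) :
    ∀ s, sl2Bracket H1 H2 s = 0 := by
  intro s
  subst hH1
  rw [sl2Bracket_sum_sub_third]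
  have hdiff : DifferentiableAt ℂ H2 s := by
    subst hH2
    refine DifferentiableAt.add (DifferentiableAt.sub ?_ (by fun_prop)) (by fun_prop)
    refine DifferentiableAt.fun_sum fun m _ => DifferentiableAt.fun_sum fun l _ => ?_
    split_ifs <;> fun_prop
  rw [← hdiff.lineDeriv_eq_fderiv]
  refine HasLineDerivAt.lineDeriv ?_
  have hlin (a b : ℂ) : HasDerivAt (fun t : ℂ => a + t * b) b 0 := by
    simpa using ((hasDerivAt_id (0 : ℂ)).mul_const b).const_add a
  have hprod (m l : Fin n) : HasDerivAt (fun t : ℂ => if l < m then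
      ((s m 0 + t * -s m 1) - Complex.I * (s m 1 + t * s m 0)) *
        ((s l 0 + t * -s l 1) + Complex.I * (s l 1 + t * s l 0)) else 0) 0 0 := by
    split_ifs
    · refine HasDerivAt.congr_deriv (((hlin (s m 0) (-s m 1)).sub
        ((hlin (s m 1) (s m 0)).const_mul Complex.I)).mul
        ((hlin (s l 0) (-s l 1)).add ((hlin (s l 1) (s l 0)).const_mul Complex.I))) ?_
      simp only [Pi.sub_apply, zero_mul, add_zero]
      linear_combination -(s m 1 * s l 0 + s m 0 * s l 1) * Complex.I_sq
    · exact hasDerivAt_const _ _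
  have hsum := HasDerivAt.fun_sum (u := Finset.univ) fun m _ =>
    HasDerivAt.fun_sum (u := Finset.univ) fun l _ => hprod m l
  simp only [Finset.sum_const_zero] at hsum
  simpa [HasLineDerivAt, hH2, rotationField] using
    (hsum.sub_const ((1 / 2) * ∑ m, (c m - s m 2) ^ 2)).add_const
      ((1 / 2) * (∑ m, (c m - s m 2)) ^ 2)

end
end

section
/- On ℝ^6, the quadratic bivector P_1 of the Goryachev–Chaplygin/Kowalevski system, determined by the elementary brackets {x_1,x_2}_1 = −x_3^2, {x_1,x_3}_1 = x_3x_2, {x_2,x_3}_1 = −x_3x_1, {x_1,J_1}_1 = −x_2J_1, {x_1,J_2}_1 = −x_2J_2, {x_1,J_3}_1 = x_3J_2 − 2x_2J_3, {x_2,J_1}_1 = x_1J_1, {x_2,J_2}_1 = x_1J_2, {x_2,J_3}_1 = 2x_1J_3 − x_3J_1, {x_3,J_1}_1 = 0, {x_3,J_2}_1 = 0, {x_3,J_3}_1 = x_2J_1 − x_1J_2, {J_1,J_2}_1 = −J_1^2 − J_2^2, {J_1,J_3}_1 = −J_3J_2, {J_2,J_3}_1 = J_1J_3, is a Poisson bivector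 compatible with the e(3) Lie–Poisson bivector P_0: for all a, b ∈ ℝ, the bracket a{.,.}_0 + b{.,.}_1 satisfies the Jacobi identity. -/
noncomputable section

/-- Phase space `ℝ⁶ = (Fin 3 → ℝ) × (Fin 3 → ℝ)`, coordinates `(x, J)` (Lean indices
`0,1,2` standing for `1,2,3`).  Partial derivative with respect to `x_i`. -/
def pdX (F : (Fin 3 → ℝ) × (Fin 3 → ℝ) → ℝ) (i : Fin 3)
    (z : (Fin 3 → ℝ) × (Fin 3 → ℝ)) : ℝ :=
  fderiv ℝ F z (Pi.single i 1, 0)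

/-- Partial derivative with respect to `J_i`. -/
def pdJ (F : (Fin 3 → ℝ) × (Fin 3 → ℝ) → ℝ) (i : Fin 3)
    (z : (Fin 3 → ℝ) × (Fin 3 → ℝ)) : ℝ :=
  fderiv ℝ F z (0, Pi.single i 1)

/-- The totally antisymmetric symbol `ε` on `Fin 3` with `ε₀₁₂ = 1`. -/
def epsR (i j k : Fin 3) : ℝ :=
  if (i, j, k) = (0, 1, 2) ∨ (i, j, k) = (1, 2, 0) ∨ (i, j, k) = (2, 0, 1) then 1
  else if (i, j, k) = (2, 1, 0) ∨ (i, j, k) = (0, 2, 1) ∨ (i, j, k) = (1, 0, 2) then -1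
  else 0

/-- The `e(3)` Lie–Poisson bracket, the biderivation determined by `{x_i,x_j}_0 = 0`,
`{x_i,J_j}_0 = ε_{ijk} x_k`, `{J_i,J_j}_0 = ε_{ijk} J_k`:
`{F,G}_0 = Σ_{ijk} ε_{ijk} (x_k (∂_{x_i}F ∂_{J_j}G + ∂_{J_i}F ∂_{x_j}G) + J_k ∂_{J_i}F ∂_{J_j}G)`. -/
def e3Br (F G : (Fin 3 → ℝ) × (Fin 3 → ℝ) → ℝ) (z : (Fin 3 → ℝ) × (Fin 3 → ℝ)) : ℝ :=
  ∑ i : Fin 3, ∑ j : Fin 3, ∑ k : Fin 3, epsR i j k *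
    (z.1 k * (pdX F i z * pdJ G j z + pdJ F i z * pdX G j z)
      + z.2 k * (pdJ F i z * pdJ G j z))

/-- The quadratic bracket `{.,.}_1` of the Goryachev–Chaplygin/Kowalevski system, written
as `Σ_{a<b} π_{ab}(∂_a F ∂_b G − ∂_b F ∂_a G)` over the 15 pairs of coordinates, with the
elementary brackets `π_{ab}` as listed (indices `0,1,2` standing for `1,2,3`). -/
def gcBr1 (F G : (Fin 3 → ℝ) × (Fin 3 → ℝ) → ℝ) (z : (Fin 3 → ℝ) × (Fin 3 → ℝ)) : ℝ :=
  -- {x₁,x₂}₁ = −x₃²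
  (-(z.1 2) ^ 2) * (pdX F 0 z * pdX G 1 z - pdX F 1 z * pdX G 0 z)
  -- {x₁,x₃}₁ = x₃x₂
  + (z.1 2 * z.1 1) * (pdX F 0 z * pdX G 2 z - pdX F 2 z * pdX G 0 z)
  -- {x₂,x₃}₁ = −x₃x₁
  + (-(z.1 2 * z.1 0)) * (pdX F 1 z * pdX G 2 z - pdX F 2 z * pdX G 1 z)
  -- {x₁,J₁}₁ = −x₂J₁
  + (-(z.1 1 * z.2 0)) * (pdX F 0 z * pdJ G 0 z - pdJ F 0 z * pdX G 0 z)
  -- {x₁,J₂}₁ = −x₂J₂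
  + (-(z.1 1 * z.2 1)) * (pdX F 0 z * pdJ G 1 z - pdJ F 1 z * pdX G 0 z)
  -- {x₁,J₃}₁ = x₃J₂ − 2x₂J₃
  + (z.1 2 * z.2 1 - 2 * z.1 1 * z.2 2) * (pdX F 0 z * pdJ G 2 z - pdJ F 2 z * pdX G 0 z)
  -- {x₂,J₁}₁ = x₁J₁
  + (z.1 0 * z.2 0) * (pdX F 1 z * pdJ G 0 z - pdJ F 0 z * pdX G 1 z)
  -- {x₂,J₂}₁ = x₁J₂
  + (z.1 0 * z.2 1) * (pdX F 1 z * pdJ G 1 z - pdJ F 1 z * pdX G 1 z)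
  -- {x₂,J₃}₁ = 2x₁J₃ − x₃J₁
  + (2 * z.1 0 * z.2 2 - z.1 2 * z.2 0) * (pdX F 1 z * pdJ G 2 z - pdJ F 2 z * pdX G 1 z)
  -- {x₃,J₁}₁ = 0, {x₃,J₂}₁ = 0
  -- {x₃,J₃}₁ = x₂J₁ − x₁J₂
  + (z.1 1 * z.2 0 - z.1 0 * z.2 1) * (pdX F 2 z * pdJ G 2 z - pdJ F 2 z * pdX G 2 z)
  -- {J₁,J₂}₁ = −J₁² − J₂²
  + (-(z.2 0) ^ 2 - (z.2 1) ^ 2) * (pdJ F 0 z * pdJ G 1 z - pdJ F 1 z * pdJ G 0 z)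
  -- {J₁,J₃}₁ = −J₃J₂
  + (-(z.2 2 * z.2 1)) * (pdJ F 0 z * pdJ G 2 z - pdJ F 2 z * pdJ G 0 z)
  -- {J₂,J₃}₁ = J₁J₃
  + (z.2 0 * z.2 2) * (pdJ F 1 z * pdJ G 2 z - pdJ F 2 z * pdJ G 1 z)

/-- The pencil `a{.,.}_0 + b{.,.}_1`. -/
def gcPencil (a b : ℝ) (F G : (Fin 3 → ℝ) × (Fin 3 → ℝ) → ℝ)
    (z : (Fin 3 → ℝ) × (Fin 3 → ℝ)) : ℝ :=
  a * e3Br F G z + b * gcBr1 F G z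

theorem cyclic_eq_zero_of_lt {ι : Type*} [LinearOrder ι] {T : ι → ι → ι → ℝ}
    (hrot : ∀ i j k, T j k i = T i j k) (hswap : ∀ i j k, T j i k = -T i j k)
    (hT : ∀ i j k, i < j → j < k → T i j k = 0) (i j k : ι) : T i j k = 0 := by
  have hdiag : ∀ i k, T i i k = 0 := fun i k => by linarith [hswap i i k]
  rcases lt_trichotomy i j with hij | rfl | hij
  · rcases lt_trichotomy j k with hjk | rfl | hjk
    · exact hT i j k hij hjk
    · rw [← hrot, hdiag]
    · rcases lt_trichotomy i k with hik | rfl | hik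
      · rw [← hrot, hswap, ← hrot, ← hrot, hT _ _ _ hik hjk, neg_zero]
      · rw [← hrot, ← hrot, hdiag]
      · rw [← hrot, ← hrot, hT _ _ _ hik hij]
  · exact hdiag i k
  · rw [hswap, neg_eq_zero]
    rcases lt_trichotomy i k with hik | rfl | hik
    · exact hT j i k hij hik
    · rw [← hrot, hdiag]
    · rcases lt_trichotomy j k with hjk | rfl | hjk
      · rw [← hrot, hswap, ← hrot, ← hrot, hT _ _ _ hjk hik, neg_zero]
      · rw [← hrot, ← hrot, hdiag]
      · rw [← hrot, ← hrot, hT _ _ _ hjk hij]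

section PoissonBivector

variable {E ι : Type*} [NormedAddCommGroup E] [NormedSpace ℝ E] [Fintype ι]

/-- The bracket with coefficients `p i j` along the directions `e i`. -/
def bivectorBracket (e : ι → E) (p : ι → ι → E → ℝ) (F G : E → ℝ) (z : E) : ℝ :=
  ∑ i, ∑ j, p i j z * (fderiv ℝ F z (e i) * fderiv ℝ G z (e j))

theorem fderiv_bivectorBracket_apply (e : ι → E) {p : ι → ι → E → ℝ}
    (hp : ∀ i j, Differentiable ℝ (p i j)) {F G : E → ℝ} (hF : ContDiff ℝ 2 F)
    (hG : ContDiff ℝ 2 G) (z v : E) :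
    fderiv ℝ (bivectorBracket e p F G) z v =
      ∑ i, ∑ j, (fderiv ℝ (p i j) z v * (fderiv ℝ F z (e i) * fderiv ℝ G z (e j))
        + p i j z * (fderiv ℝ (fderiv ℝ F) z v (e i) * fderiv ℝ G z (e j))
        + p i j z * (fderiv ℝ F z (e i) * fderiv ℝ (fderiv ℝ G) z v (e j))) := by
  have hd : ∀ {K : E → ℝ}, ContDiff ℝ 2 K → ∀ w : E,
      HasFDerivAt (fun y => fderiv ℝ K y w) ((fderiv ℝ (fderiv ℝ K) z).flip w) z := by
    intro K hK w
    have h := ((hK.fderiv_right (m := 1) (by norm_num)).differentiable (by norm_num) z).hasFDerivAt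
    simpa using h.clm_apply (hasFDerivAt_const w z)
  have h : HasFDerivAt (bivectorBracket e p F G) _ z :=
    HasFDerivAt.fun_sum fun i (_ : i ∈ Finset.univ) => HasFDerivAt.fun_sum
      fun j (_ : j ∈ Finset.univ) =>
        ((hp i j) z).hasFDerivAt.mul ((hd hF (e i)).mul (hd hG (e j)))
  rw [h.fderiv]
  simp only [sum_apply, add_apply, smul_apply, ContinuousLinearMap.flip_apply, smul_eq_mul]
  exact Finset.sum_congr rfl fun i _ => Finset.sum_congr rfl fun j _ => by ring

theorem sum_hessian_add_sum_hessian_eq_zero {p A : ι → ι → ℝ} (hp : ∀ i j, p j i = -p i j)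
    (hA : ∀ i j, A i j = A j i) (g h : ι → ℝ) :
    ∑ l, ∑ k, p l k * ((∑ i, ∑ j, p i j * (A l i * g j)) * h k)
      + ∑ l, ∑ k, p l k * ((∑ i, ∑ j, p i j * (h i * A l j)) * g k) = 0 := by
  have h₂ : ∑ l, ∑ k, p l k * ((∑ i, ∑ j, p i j * (h i * A l j)) * g k)
      = -∑ l, ∑ k, p l k * ((∑ i, ∑ j, p i j * (A l i * g j)) * h k) := by
    simp only [Finset.sum_mul, Finset.mul_sum, ← Finset.sum_neg_distrib]
    calc _ = ∑ l, ∑ k, ∑ j, ∑ i, p l k * (p i j * (h i * A l j) * g k) :=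
          Finset.sum_congr rfl fun l _ => Finset.sum_congr rfl fun k _ => Finset.sum_comm
      _ = ∑ l, ∑ j, ∑ k, ∑ i, p l k * (p i j * (h i * A l j) * g k) :=
          Finset.sum_congr rfl fun l _ => Finset.sum_comm
      _ = ∑ j, ∑ l, ∑ k, ∑ i, p l k * (p i j * (h i * A l j) * g k) := Finset.sum_comm
      _ = ∑ j, ∑ l, ∑ i, ∑ k, p l k * (p i j * (h i * A l j) * g k) :=
          Finset.sum_congr rfl fun l _ => Finset.sum_congr rfl fun k _ => Finset.sum_comm
      _ = ∑ j, ∑ i, ∑ l, ∑ k, p l k * (p i j * (h i * A l j) * g k) :=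
          Finset.sum_congr rfl fun l _ => Finset.sum_comm
      _ = _ := by
          refine Finset.sum_congr rfl fun l _ => Finset.sum_congr rfl fun k _ =>
            Finset.sum_congr rfl fun i _ => Finset.sum_congr rfl fun j _ => ?_
          rw [hp l k, hA i l]
          ring
  rw [h₂, add_neg_cancel]

theorem sum_cyclic_eq_zero {p : ι → ι → ℝ} {D : ι → ι → ι → ℝ}
    (hD : ∀ i j k, ∑ l, (p l k * D l i j + p l i * D l j k + p l j * D l k i) = 0)
    (f g h : ι → ℝ) :
    ∑ l, ∑ k, p l k * ((∑ i, ∑ j, D l i j * (f i * g j)) * h k)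
      + ∑ l, ∑ k, p l k * ((∑ i, ∑ j, D l i j * (g i * h j)) * f k)
      + ∑ l, ∑ k, p l k * ((∑ i, ∑ j, D l i j * (h i * f j)) * g k) = 0 := by
  have key : ∀ u v w : ι → ℝ, ∑ l, ∑ k, p l k * ((∑ i, ∑ j, D l i j * (u i * v j)) * w k)
      = ∑ i, ∑ j, ∑ k, (∑ l, p l k * D l i j) * (u i * v j * w k) := by
    intro u v w
    simp only [Finset.sum_mul, Finset.mul_sum]
    calc _ = ∑ l, ∑ i, ∑ k, ∑ j, p l k * (D l i j * (u i * v j) * w k) :=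
          Finset.sum_congr rfl fun l _ => Finset.sum_comm
      _ = ∑ i, ∑ l, ∑ k, ∑ j, p l k * (D l i j * (u i * v j) * w k) := Finset.sum_comm
      _ = ∑ i, ∑ l, ∑ j, ∑ k, p l k * (D l i j * (u i * v j) * w k) :=
          Finset.sum_congr rfl fun i _ => Finset.sum_congr rfl fun l _ => Finset.sum_comm
      _ = ∑ i, ∑ j, ∑ l, ∑ k, p l k * (D l i j * (u i * v j) * w k) :=
          Finset.sum_congr rfl fun i _ => Finset.sum_comm
      _ = ∑ i, ∑ j, ∑ k, ∑ l, p l k * (D l i j * (u i * v j) * w k) :=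
          Finset.sum_congr rfl fun i _ => Finset.sum_congr rfl fun l _ => Finset.sum_comm
      _ = _ := by
          refine Finset.sum_congr rfl fun i _ => Finset.sum_congr rfl fun j _ =>
            Finset.sum_congr rfl fun k _ => Finset.sum_congr rfl fun l _ => ?_
          ring
  have rot : ∀ T : ι → ι → ι → ℝ, ∑ i, ∑ j, ∑ k, T i j k = ∑ i, ∑ j, ∑ k, T j k i := fun T => by
    calc _ = ∑ j, ∑ i, ∑ k, T i j k := Finset.sum_comm
      _ = ∑ j, ∑ k, ∑ i, T i j k := Finset.sum_congr rfl fun j _ => Finset.sum_comm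
      _ = ∑ k, ∑ j, ∑ i, T i j k := Finset.sum_comm
      _ = _ := Finset.sum_congr rfl fun j _ => Finset.sum_comm
  rw [key, key, key, ← rot fun i j k => (∑ l, p l j * D l k i) * (h k * f i * g j),
    rot fun i j k => (∑ l, p l k * D l i j) * (g i * h j * f k)]
  simp only [← Finset.sum_add_distrib]
  refine Finset.sum_eq_zero fun i _ => Finset.sum_eq_zero fun j _ =>
    Finset.sum_eq_zero fun k _ => ?_
  have := hD i j k
  simp only [Finset.sum_add_distrib] at this
  linear_combination (f i * g j * h k) * this

/-- The Schouten square of a bivector is determined by its components with increasing indices. -/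
theorem schouten_eq_zero_of_lt [LinearOrder ι] (e : ι → E) {p : ι → ι → E → ℝ}
    (hskew : ∀ i j z, p j i z = -p i j z) (z : E)
    (hlt : ∀ i j k, i < j → j < k → ∑ l, (p l k z * fderiv ℝ (p i j) z (e l)
      + p l i z * fderiv ℝ (p j k) z (e l) + p l j z * fderiv ℝ (p k i) z (e l)) = 0)
    (i j k : ι) : ∑ l, (p l k z * fderiv ℝ (p i j) z (e l)
      + p l i z * fderiv ℝ (p j k) z (e l) + p l j z * fderiv ℝ (p k i) z (e l)) = 0 := by
  have hneg : ∀ i j v, fderiv ℝ (p j i) z v = -fderiv ℝ (p i j) z v := fun i j v => by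
    rw [show p j i = fun y => -p i j y from funext (hskew i j), fderiv_fun_neg,
      neg_apply]
  refine cyclic_eq_zero_of_lt (T := fun i j k => ∑ l, (p l k z * fderiv ℝ (p i j) z (e l)
    + p l i z * fderiv ℝ (p j k) z (e l) + p l j z * fderiv ℝ (p k i) z (e l)))
    (fun i j k => Finset.sum_congr rfl fun l _ => by ring) (fun i j k => ?_) hlt i j k
  rw [← Finset.sum_neg_distrib]
  refine Finset.sum_congr rfl fun l _ => ?_
  rw [hneg i j, hneg k i, hneg j k]
  ring

/-- The Jacobi identity for a skew-symmetric bivector with vanishing Schouten square. -/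
theorem bivectorBracket_jacobi (e : ι → E) {p : ι → ι → E → ℝ}
    (hp : ∀ i j, Differentiable ℝ (p i j)) (hskew : ∀ i j z, p j i z = -p i j z)
    (hschouten : ∀ i j k z, ∑ l, (p l k z * fderiv ℝ (p i j) z (e l)
      + p l i z * fderiv ℝ (p j k) z (e l) + p l j z * fderiv ℝ (p k i) z (e l)) = 0)
    {F G H : E → ℝ} (hF : ContDiff ℝ 2 F) (hG : ContDiff ℝ 2 G) (hH : ContDiff ℝ 2 H) (z : E) :
    bivectorBracket e p (bivectorBracket e p F G) H z
      + bivectorBracket e p (bivectorBracket e p G H) F z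
      + bivectorBracket e p (bivectorBracket e p H F) G z = 0 := by
  have expand : ∀ {K L : E → ℝ} (M : E → ℝ), ContDiff ℝ 2 K → ContDiff ℝ 2 L →
      bivectorBracket e p (bivectorBracket e p K L) M z =
        ∑ l, ∑ k, p l k z * ((∑ i, ∑ j, fderiv ℝ (p i j) z (e l) *
            (fderiv ℝ K z (e i) * fderiv ℝ L z (e j))) * fderiv ℝ M z (e k))
        + ∑ l, ∑ k, p l k z * ((∑ i, ∑ j, p i j z *
            (fderiv ℝ (fderiv ℝ K) z (e l) (e i) * fderiv ℝ L z (e j))) * fderiv ℝ M z (e k))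
        + ∑ l, ∑ k, p l k z * ((∑ i, ∑ j, p i j z *
            (fderiv ℝ K z (e i) * fderiv ℝ (fderiv ℝ L) z (e l) (e j))) *
              fderiv ℝ M z (e k)) := by
    intro K L M hK hL
    rw [bivectorBracket]
    simp only [fderiv_bivectorBracket_apply e hp hK hL, Finset.sum_add_distrib, mul_add, add_mul]
  have symm : ∀ {K : E → ℝ}, ContDiff ℝ 2 K → ∀ i j,
      fderiv ℝ (fderiv ℝ K) z (e i) (e j) = fderiv ℝ (fderiv ℝ K) z (e j) (e i) :=
    fun hK i j => (hK.contDiffAt.isSymmSndFDerivAt (by simp)) (e i) (e j)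
  rw [expand H hF hG, expand F hG hH, expand G hH hF]
  have cF := sum_hessian_add_sum_hessian_eq_zero (p := fun i j => p i j z)
    (fun i j => hskew i j z) (symm hF) (fun i => fderiv ℝ G z (e i)) (fun i => fderiv ℝ H z (e i))
  have cG := sum_hessian_add_sum_hessian_eq_zero (p := fun i j => p i j z)
    (fun i j => hskew i j z) (symm hG) (fun i => fderiv ℝ H z (e i)) (fun i => fderiv ℝ F z (e i))
  have cH := sum_hessian_add_sum_hessian_eq_zero (p := fun i j => p i j z)
    (fun i j => hskew i j z) (symm hH) (fun i => fderiv ℝ F z (e i)) (fun i => fderiv ℝ G z (e i))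
  have c := sum_cyclic_eq_zero (p := fun i j => p i j z)
    (D := fun l i j => fderiv ℝ (p i j) z (e l)) (fun i j k => hschouten i j k z)
    (fun i => fderiv ℝ F z (e i)) (fun i => fderiv ℝ G z (e i)) (fun i => fderiv ℝ H z (e i))
  linear_combination c + cF + cG + cH

end PoissonBivector

/-- The derivative of a quadratic polynomial is its symmetric difference quotient. -/
theorem fderiv_apply_eq_of_quadratic {E : Type*} [NormedAddCommGroup E] [NormedSpace ℝ E]
    {q : E → ℝ} {z v : E} {c d : ℝ} (hq : DifferentiableAt ℝ q z)
    (h : ∀ t : ℝ, q (z + t • v) = q z + t * c + t ^ 2 * d) : fderiv ℝ q z v = c := by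
  rw [← hq.lineDeriv_eq_fderiv, lineDeriv]
  simp only [h]
  have h₁ := (((hasDerivAt_id (0 : ℝ)).mul_const c).const_add (q z)).add
    (((hasDerivAt_id (0 : ℝ)).pow 2).mul_const d)
  exact (h₁.congr_deriv (by simp)).deriv

/-- The coordinate directions `x₁, x₂, x₃, J₁, J₂, J₃`. -/
def e3Direction : Fin 6 → (Fin 3 → ℝ) × (Fin 3 → ℝ) :=
  ![(Pi.single 0 1, 0), (Pi.single 1 1, 0), (Pi.single 2 1, 0),
    (0, Pi.single 0 1), (0, Pi.single 1 1), (0, Pi.single 2 1)]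

/-- The matrix of elementary brackets of `gcPencil` in the coordinates `(x, J)`. -/
def gcPencilMatrix (a b x y z u v w : ℝ) : Fin 6 → Fin 6 → ℝ :=
  a • ![![0, 0, 0, 0, z, -y], ![0, 0, 0, -z, 0, x], ![0, 0, 0, y, -x, 0],
    ![0, z, -y, 0, w, -v], ![-z, 0, x, -w, 0, u], ![y, -x, 0, v, -u, 0]] +
  b • ![![0, -z ^ 2, z * y, -(y * u), -(y * v), z * v - 2 * y * w],
    ![z ^ 2, 0, -(z * x), x * u, x * v, 2 * x * w - z * u],
    ![-(z * y), z * x, 0, 0, 0, y * u - x * v],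
    ![y * u, -(x * u), 0, 0, -u ^ 2 - v ^ 2, -(w * v)],
    ![y * v, -(x * v), 0, u ^ 2 + v ^ 2, 0, u * w],
    ![2 * y * w - z * v, z * u - 2 * x * w, x * v - y * u, w * v, -(u * w), 0]]

/-- The elementary brackets of `gcPencil` as functions on phase space. -/
def gcPencilCoeff (a b : ℝ) (i j : Fin 6) (z : (Fin 3 → ℝ) × (Fin 3 → ℝ)) : ℝ :=
  gcPencilMatrix a b (z.1 0) (z.1 1) (z.1 2) (z.2 0) (z.2 1) (z.2 2) i j

theorem gcPencil_eq_bivectorBracket (a b : ℝ) (F G : (Fin 3 → ℝ) × (Fin 3 → ℝ) → ℝ) :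
    gcPencil a b F G = bivectorBracket e3Direction (gcPencilCoeff a b) F G := by
  funext z
  simp [gcPencil, e3Br, gcBr1, epsR, bivectorBracket, gcPencilCoeff, gcPencilMatrix, e3Direction,
    Fin.sum_univ_succ, pdX, pdJ]
  ring

theorem differentiable_gcPencilCoeff (a b : ℝ) (i j : Fin 6) :
    Differentiable ℝ (gcPencilCoeff a b i j) := by
  unfold gcPencilCoeff
  fin_cases i <;> fin_cases j <;> simp [gcPencilMatrix] <;> fun_prop

theorem gcPencilMatrix_skew (a b x y z u v w : ℝ) (i j : Fin 6) :
    gcPencilMatrix a b x y z u v w j i = -gcPencilMatrix a b x y z u v w i j := by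
  fin_cases i <;> fin_cases j <;> simp [gcPencilMatrix] <;> ring

set_option maxHeartbeats 1000000 in
theorem fderiv_gcPencilCoeff_apply (a b : ℝ) (i j : Fin 6) (z v : (Fin 3 → ℝ) × (Fin 3 → ℝ)) :
    fderiv ℝ (gcPencilCoeff a b i j) z v =
      (gcPencilCoeff a b i j (z + v) - gcPencilCoeff a b i j (z - v)) / 2 := by
  refine fderiv_apply_eq_of_quadratic (d := (gcPencilCoeff a b i j (z + v)
    + gcPencilCoeff a b i j (z - v)) / 2 - gcPencilCoeff a b i j z)
    (differentiable_gcPencilCoeff a b i j z) fun t => ?_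
  fin_cases i <;> fin_cases j <;> simp [gcPencilCoeff, gcPencilMatrix] <;> ring

set_option maxHeartbeats 2000000 in
theorem gcPencilCoeff_schouten (a b : ℝ) (i j k : Fin 6) (z : (Fin 3 → ℝ) × (Fin 3 → ℝ)) :
    ∑ l, (gcPencilCoeff a b l k z * fderiv ℝ (gcPencilCoeff a b i j) z (e3Direction l)
      + gcPencilCoeff a b l i z * fderiv ℝ (gcPencilCoeff a b j k) z (e3Direction l)
      + gcPencilCoeff a b l j z * fderiv ℝ (gcPencilCoeff a b k i) z (e3Direction l)) = 0 := by
  refine schouten_eq_zero_of_lt e3Direction (p := gcPencilCoeff a b)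
    (fun i j z => gcPencilMatrix_skew a b _ _ _ _ _ _ i j) z (fun i j k hij hjk => ?_) i j k
  simp only [fderiv_gcPencilCoeff_apply, Fin.sum_univ_six]
  fin_cases i <;> fin_cases j <;> try exact absurd hij (by decide)
  all_goals
    fin_cases k <;> try exact absurd hjk (by decide)
  all_goals
    simp [gcPencilCoeff, gcPencilMatrix, e3Direction]
    ring

/-!
STATEMENT 17: the quadratic bivector P₁ is a Poisson bivector compatible with the `e(3)`
Lie–Poisson bivector P₀: for all a, b ∈ ℝ the bracket a{.,.}_0 + b{.,.}_1 satisfies the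
Jacobi identity.
-/
theorem gc_pencil_jacobi (a b : ℝ) (F G H : (Fin 3 → ℝ) × (Fin 3 → ℝ) → ℝ)
    (hF : ContDiff ℝ (⊤ : ℕ∞) F) (hG : ContDiff ℝ (⊤ : ℕ∞) G) (hH : ContDiff ℝ (⊤ : ℕ∞) H) :
    ∀ z, gcPencil a b (gcPencil a b F G) H z
      + gcPencil a b (gcPencil a b G H) F z
      + gcPencil a b (gcPencil a b H F) G z = 0 := by
  intro z
  simp only [gcPencil_eq_bivectorBracket]
  exact bivectorBracket_jacobi e3Direction (differentiable_gcPencilCoeff a b)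
    (fun i j z => gcPencilMatrix_skew a b _ _ _ _ _ _ i j) (gcPencilCoeff_schouten a b)
    (contDiff_infty.1 hF 2) (contDiff_infty.1 hG 2) (contDiff_infty.1 hH 2) z

end
end

section
/- The Kowalevski gyrostat Hamiltonian is bi-Hamiltonian with respect to the pair (P_0, P_1): for every smooth function F on ℝ^6 and every α ∈ ℝ, {F, (1/2)(J_1^2 + J_2^2 + 2J_3^2) + αJ_3}_0 = {F, J_3}_1 + α{F, J_3}_0; equivalently, the P_0-Hamiltonian vector field of (1/2)(J_1^2+J_2^2+2J_3^2) coincides with the P_1-Hamiltonian vector field of J_3. -/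
noncomputable section

/-- The coordinate function `J_i` as a continuous linear functional on phase space. -/
def coordJ (i : Fin 3) : (Fin 3 → ℝ) × (Fin 3 → ℝ) →L[ℝ] ℝ :=
  (ContinuousLinearMap.proj i).comp (ContinuousLinearMap.snd ℝ (Fin 3 → ℝ) (Fin 3 → ℝ))

theorem hasFDerivAt_snd_apply (i : Fin 3) (z : (Fin 3 → ℝ) × (Fin 3 → ℝ)) :
    HasFDerivAt (fun w : (Fin 3 → ℝ) × (Fin 3 → ℝ) => w.2 i) (coordJ i) z :=
  (coordJ i).hasFDerivAt

theorem pdX_snd_apply (i j : Fin 3) (z : (Fin 3 → ℝ) × (Fin 3 → ℝ)) :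
    pdX (fun w => w.2 j) i z = 0 := by
  simp [pdX, (hasFDerivAt_snd_apply j z).fderiv, coordJ]

theorem pdJ_snd_apply (i j : Fin 3) (z : (Fin 3 → ℝ) × (Fin 3 → ℝ)) :
    pdJ (fun w => w.2 j) i z = if j = i then 1 else 0 := by
  simp [pdJ, (hasFDerivAt_snd_apply j z).fderiv, coordJ, Pi.single_apply]

/-- Total derivative of the Kowalevski gyrostat Hamiltonian. -/
theorem hasFDerivAt_gyrostat (α : ℝ) (z : (Fin 3 → ℝ) × (Fin 3 → ℝ)) :
    HasFDerivAt (fun w : (Fin 3 → ℝ) × (Fin 3 → ℝ) =>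
        (1 / 2) * ((w.2 0) ^ 2 + (w.2 1) ^ 2 + 2 * (w.2 2) ^ 2) + α * w.2 2)
      (z.2 0 • coordJ 0 + z.2 1 • coordJ 1 + (2 * z.2 2 + α) • coordJ 2) z := by
  have h := (((((hasFDerivAt_snd_apply 0 z).pow 2).add ((hasFDerivAt_snd_apply 1 z).pow 2)).add
    (((hasFDerivAt_snd_apply 2 z).pow 2).const_mul 2)).const_mul (1 / 2)).add
    ((hasFDerivAt_snd_apply 2 z).const_mul α)
  refine h.congr_fderiv (ContinuousLinearMap.ext fun v => ?_)
  simp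
  ring

theorem pdX_gyrostat (α : ℝ) (i : Fin 3) (z : (Fin 3 → ℝ) × (Fin 3 → ℝ)) :
    pdX (fun w => (1 / 2) * ((w.2 0) ^ 2 + (w.2 1) ^ 2 + 2 * (w.2 2) ^ 2) + α * w.2 2) i z = 0 := by
  rw [pdX, (hasFDerivAt_gyrostat α z).fderiv]
  simp [coordJ]

theorem pdJ_gyrostat (α : ℝ) (i : Fin 3) (z : (Fin 3 → ℝ) × (Fin 3 → ℝ)) :
    pdJ (fun w => (1 / 2) * ((w.2 0) ^ 2 + (w.2 1) ^ 2 + 2 * (w.2 2) ^ 2) + α * w.2 2) i z =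
      ![z.2 0, z.2 1, 2 * z.2 2 + α] i := by
  rw [pdJ, (hasFDerivAt_gyrostat α z).fderiv]
  fin_cases i <;> simp [coordJ]

/-!
STATEMENT 18: the Kowalevski gyrostat Hamiltonian is bi-Hamiltonian with respect to
(P₀, P₁): for every smooth F and every α ∈ ℝ,
{F, ½(J₁² + J₂² + 2J₃²) + αJ₃}_0 = {F, J₃}_1 + α{F, J₃}_0.
-/
theorem kowalevski_biHamiltonian (α : ℝ) (F : (Fin 3 → ℝ) × (Fin 3 → ℝ) → ℝ)
    (hF : ContDiff ℝ (⊤ : ℕ∞) F) :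
    ∀ z, e3Br F (fun w => (1 / 2) * ((w.2 0) ^ 2 + (w.2 1) ^ 2 + 2 * (w.2 2) ^ 2)
        + α * w.2 2) z =
      gcBr1 F (fun w => w.2 2) z + α * e3Br F (fun w => w.2 2) z := by
  intro z
  simp only [e3Br, gcBr1, pdX_gyrostat, pdJ_gyrostat, pdX_snd_apply, pdJ_snd_apply]
  simp [Fin.sum_univ_three, epsR]
  ring

end
end

section
/- For the Goryachev–Chaplygin gyrostat with Hamiltonian H := J_1^2 + J_2^2 + 4J_3^2 + 2ρJ_3 − 2a·x_1 and Chaplygin integral K := (2J_3 + ρ)(J_1^2 + J_2^2) + 2a·x_3 J_1 (a, ρ ∈ ℝ), the e(3) Lie–Poisson bracket satisfies the identity {H, K}_0 = 4a·J_2·(x_1J_1 + x_2J_2 + x_3J_3) on all of ℝ^6; in particular H and K are in involution at every point of the level set x_1J_1 + x_2J_2 + x_3J_3 = 0. -/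
noncomputable section

/-- The differential of the coordinate `x_i` at any point. -/
theorem hasFDerivAt_coordX (i : Fin 3) (z : (Fin 3 → ℝ) × (Fin 3 → ℝ)) :
    HasFDerivAt (fun w : (Fin 3 → ℝ) × (Fin 3 → ℝ) => w.1 i)
      ((ContinuousLinearMap.proj (R := ℝ) (φ := fun _ : Fin 3 => ℝ) i).comp
        (ContinuousLinearMap.fst ℝ (Fin 3 → ℝ) (Fin 3 → ℝ))) z :=
  ((ContinuousLinearMap.proj (R := ℝ) (φ := fun _ : Fin 3 => ℝ) i).comp
    (ContinuousLinearMap.fst ℝ (Fin 3 → ℝ) (Fin 3 → ℝ))).hasFDerivAt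

/-- The differential of the coordinate `J_i` at any point. -/
theorem hasFDerivAt_coordJ (i : Fin 3) (z : (Fin 3 → ℝ) × (Fin 3 → ℝ)) :
    HasFDerivAt (fun w : (Fin 3 → ℝ) × (Fin 3 → ℝ) => w.2 i)
      ((ContinuousLinearMap.proj (R := ℝ) (φ := fun _ : Fin 3 => ℝ) i).comp
        (ContinuousLinearMap.snd ℝ (Fin 3 → ℝ) (Fin 3 → ℝ))) z :=
  ((ContinuousLinearMap.proj (R := ℝ) (φ := fun _ : Fin 3 => ℝ) i).comp
    (ContinuousLinearMap.snd ℝ (Fin 3 → ℝ) (Fin 3 → ℝ))).hasFDerivAt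

/-- The differential of the Goryachev–Chaplygin Hamiltonian. -/
theorem fderiv_hamiltonian_apply (a ρ : ℝ) (z v : (Fin 3 → ℝ) × (Fin 3 → ℝ)) :
    fderiv ℝ (fun w : (Fin 3 → ℝ) × (Fin 3 → ℝ) => (w.2 0) ^ 2 + (w.2 1) ^ 2 + 4 * (w.2 2) ^ 2
      + 2 * ρ * w.2 2 - 2 * a * w.1 0) z v =
      2 * z.2 0 * v.2 0 + 2 * z.2 1 * v.2 1 + (8 * z.2 2 + 2 * ρ) * v.2 2 - 2 * a * v.1 0 := by
  have h := (((((hasFDerivAt_coordJ 0 z).pow 2).add ((hasFDerivAt_coordJ 1 z).pow 2)).add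
    (((hasFDerivAt_coordJ 2 z).pow 2).const_mul 4)).add
    ((hasFDerivAt_coordJ 2 z).const_mul (2 * ρ))).sub
    ((hasFDerivAt_coordX 0 z).const_mul (2 * a))
  refine (DFunLike.congr_fun h.fderiv v).trans ?_
  simp
  ring

/-- The differential of the Chaplygin integral. -/
theorem fderiv_chaplygin_apply (a ρ : ℝ) (z v : (Fin 3 → ℝ) × (Fin 3 → ℝ)) :
    fderiv ℝ (fun w : (Fin 3 → ℝ) × (Fin 3 → ℝ) =>
      (2 * w.2 2 + ρ) * ((w.2 0) ^ 2 + (w.2 1) ^ 2) + 2 * a * w.1 2 * w.2 0) z v =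
      2 * ((z.2 0) ^ 2 + (z.2 1) ^ 2) * v.2 2
        + (2 * z.2 2 + ρ) * (2 * z.2 0 * v.2 0 + 2 * z.2 1 * v.2 1)
        + 2 * a * (z.2 0 * v.1 2 + z.1 2 * v.2 0) := by
  have h := ((((hasFDerivAt_coordJ 2 z).const_mul 2).add_const ρ).mul
    (((hasFDerivAt_coordJ 0 z).pow 2).add ((hasFDerivAt_coordJ 1 z).pow 2))).add
    (((hasFDerivAt_coordX 2 z).const_mul (2 * a)).mul (hasFDerivAt_coordJ 0 z))
  refine (DFunLike.congr_fun h.fderiv v).trans ?_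
  simp
  ring

/-!
STATEMENT 19: for the Goryachev–Chaplygin gyrostat with
H = J₁² + J₂² + 4J₃² + 2ρJ₃ − 2a·x₁ and K = (2J₃ + ρ)(J₁² + J₂²) + 2a·x₃J₁,
the e(3) Lie–Poisson bracket satisfies {H, K}_0 = 4a·J₂·(x₁J₁ + x₂J₂ + x₃J₃) on all of ℝ⁶;
in particular H and K are in involution at every point of the level set
x₁J₁ + x₂J₂ + x₃J₃ = 0.
-/
theorem goryachev_chaplygin_involution (a ρ : ℝ)
    (H K : (Fin 3 → ℝ) × (Fin 3 → ℝ) → ℝ)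
    (hH : H = fun w => (w.2 0) ^ 2 + (w.2 1) ^ 2 + 4 * (w.2 2) ^ 2
      + 2 * ρ * w.2 2 - 2 * a * w.1 0)
    (hK : K = fun w => (2 * w.2 2 + ρ) * ((w.2 0) ^ 2 + (w.2 1) ^ 2)
      + 2 * a * w.1 2 * w.2 0) :
    (∀ z, e3Br H K z =
      4 * a * z.2 1 * (z.1 0 * z.2 0 + z.1 1 * z.2 1 + z.1 2 * z.2 2)) ∧
    (∀ z : (Fin 3 → ℝ) × (Fin 3 → ℝ),
      z.1 0 * z.2 0 + z.1 1 * z.2 1 + z.1 2 * z.2 2 = 0 → e3Br H K z = 0) := by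
  have bracket : ∀ z, e3Br H K z =
      4 * a * z.2 1 * (z.1 0 * z.2 0 + z.1 1 * z.2 1 + z.1 2 * z.2 2) := by
    intro z
    subst hH hK
    simp only [e3Br, pdX, pdJ, fderiv_hamiltonian_apply, fderiv_chaplygin_apply]
    simp [Fin.sum_univ_three, epsR, Pi.single_apply]
    ring
  exact ⟨bracket, fun z hz => by rw [bracket, hz, mul_zero]⟩

end
end
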